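/- arXiv:1605.03074 — 5 statements merged into one kernel-verified Lean document; each statement's English description precedes it below -/
import Mathlib

section
/- Every natural number n can be written as n = x^2 + y^2 + z^2 + w^2 with x, y, z, w nonnegative integers such that x^2 + 8yz is a perfect square (i.e., x^2 + 8yz = t^2 for some integer t). -/
/-- **Davenport–Cassels**: an integer that is a sum of three rational squares is a sum of three
integer squares. -/
theorem sum_three_sq_of_mul_sq (n : ℤ) (T : ℕ) (hT : 0 < T) (x y z : ℤ)
    (h : n * (T : ℤ) ^ 2 = x ^ 2 + y ^ 2 + z ^ 2) :
    ∃ a b c : ℤ, n = a ^ 2 + b ^ 2 + c ^ 2 := by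
  induction T using Nat.strong_induction_on generalizing x y z with
  | _ T ih =>
    have hT' : (0 : ℤ) < T := by exact_mod_cast hT
    have nearest (x : ℤ) : ∃ u : ℤ, 4 * (T * u - x) ^ 2 ≤ (T : ℤ) ^ 2 := by
      refine ⟨(2 * x + T) / (2 * T), ?_⟩
      have h1 := Int.emod_add_mul_ediv (2 * x + T) (2 * T)
      have h2 := Int.emod_nonneg (2 * x + T) (b := 2 * (T : ℤ)) (by positivity)
      have h3 := Int.emod_lt_of_pos (2 * x + T) (b := 2 * (T : ℤ)) (by positivity)
      have : 4 * (T * ((2 * x + T) / (2 * T)) - x) ^ 2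
          = (2 * (T * ((2 * x + T) / (2 * T)) - x)) ^ 2 := by ring
      rw [this]
      apply sq_le_sq' <;> linarith
    obtain ⟨u, hu⟩ := nearest x
    obtain ⟨v, hv⟩ := nearest y
    obtain ⟨w, hw⟩ := nearest z
    obtain ⟨a, ha⟩ : ∃ a, a = u ^ 2 + v ^ 2 + w ^ 2 - n := ⟨_, rfl⟩
    obtain ⟨b, hb⟩ : ∃ b, b = 2 * (n * T - (x * u + y * v + z * w)) := ⟨_, rfl⟩
    have key : (T : ℤ) * (a * T + b)
        = (T * u - x) ^ 2 + (T * v - y) ^ 2 + (T * w - z) ^ 2 := by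
      rw [ha, hb]; linear_combination h
    have hnonneg : 0 ≤ a * T + b := by
      refine nonneg_of_mul_nonneg_right ?_ hT'
      rw [key]; positivity
    have hlt : a * T + b < T := by
      refine lt_of_mul_lt_mul_left (a := (T : ℤ)) ?_ hT'.le
      nlinarith
    rcases hnonneg.eq_or_lt with h0 | hpos
    · rw [← h0, mul_zero] at key
      have hx := sq_nonneg (T * u - x)
      have hy := sq_nonneg (T * v - y)
      have hz := sq_nonneg (T * w - z)
      have h1 : (T * u - x) ^ 2 = 0 := by linarith
      have h2 : (T * v - y) ^ 2 = 0 := by linarith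
      have h3 : (T * w - z) ^ 2 = 0 := by linarith
      rw [sq_eq_zero_iff, sub_eq_zero] at h1 h2 h3
      refine ⟨u, v, w, mul_right_cancel₀ (pow_ne_zero 2 hT'.ne') ?_⟩
      rw [h, ← h1, ← h2, ← h3]; ring
    · lift a * T + b to ℕ using hnonneg with T' hT''
      refine ih T' (by exact_mod_cast hlt) (by exact_mod_cast hpos)
        (a * x + b * u) (a * y + b * v) (a * z + b * w) ?_
      rw [hT'']
      linear_combination a ^ 2 * h - a * b * hb + b ^ 2 * ha

/-- A pigeonhole lemma: small solutions of a pair of linear congruences. -/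
theorem exists_small_solution (n p : ℕ) (hn : 0 < n) (hp : 0 < p) (s : ℤ) :
    ∃ x y t : ℤ, (x ≠ 0 ∨ y ≠ 0 ∨ t ≠ 0) ∧ (n : ℤ) ∣ x - y ∧ (p : ℤ) ∣ x - s * t ∧
      x ^ 2 ≤ n * p ∧ y ^ 2 ≤ n ∧ t ^ 2 ≤ p := by
  have : NeZero n := ⟨hn.ne'⟩
  have : NeZero p := ⟨hp.ne'⟩
  let box := Finset.range (Nat.sqrt (n * p) + 1) ×ˢ
    (Finset.range (Nat.sqrt n + 1) ×ˢ Finset.range (Nat.sqrt p + 1))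
  let f : ℕ × ℕ × ℕ → ZMod n × ZMod p := fun v ↦
    (((v.1 - v.2.1 : ℤ) : ZMod n), ((v.1 - s * v.2.2 : ℤ) : ZMod p))
  have hcard : (Finset.univ : Finset (ZMod n × ZMod p)).card < box.card := by
    simp only [box, Finset.card_product, Finset.card_range, Finset.card_univ, Fintype.card_prod,
      ZMod.card]
    have h1 := Nat.lt_succ_sqrt' (n * p)
    have h2 := Nat.lt_succ_sqrt' n
    have h3 := Nat.lt_succ_sqrt' p
    refine lt_of_pow_lt_pow_left₀ 2 (Nat.zero_le _) ?_
    calc (n * p) ^ 2 = (n * p) * (n * p) := by ring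
      _ < (Nat.sqrt (n * p) + 1) ^ 2 * ((Nat.sqrt n + 1) ^ 2 * (Nat.sqrt p + 1) ^ 2) :=
        mul_lt_mul'' h1 (mul_lt_mul'' h2 h3 (Nat.zero_le _) (Nat.zero_le _))
          (Nat.zero_le _) (Nat.zero_le _)
      _ = _ := by ring
  obtain ⟨⟨x, y, t⟩, hv, ⟨x', y', t'⟩, hv', hne, heq⟩ :=
    Finset.exists_ne_map_eq_of_card_lt_of_maps_to hcard (f := f) (fun _ _ ↦ Finset.mem_univ _)
  simp only [box, Finset.mem_product, Finset.mem_range, Nat.lt_succ_iff] at hv hv'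
  simp only [f, Prod.mk.injEq] at heq
  have bound {a b m : ℕ} (ha : a ≤ Nat.sqrt m) (hb : b ≤ Nat.sqrt m) :
      ((a : ℤ) - b) ^ 2 ≤ m := by
    have hm : ((Nat.sqrt m : ℤ)) ^ 2 ≤ m := by exact_mod_cast Nat.sqrt_le' m
    refine le_trans (sq_le_sq' ?_ ?_) hm <;> lia
  refine ⟨x - x', y - y', t - t', ?_, ?_, ?_, ?_, bound hv.2.1 hv'.2.1, bound hv.2.2 hv'.2.2⟩
  · by_contra! hcon
    apply hne
    simp only [Prod.mk.injEq]
    lia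
  · have := (ZMod.intCast_eq_intCast_iff_dvd_sub _ _ _).1 heq.1.symm
    convert this using 1; ring
  · have := (ZMod.intCast_eq_intCast_iff_dvd_sub _ _ _).1 heq.2.symm
    convert this using 1; ring
  · exact_mod_cast bound hv.1 hv'.1

/-- A special case of Legendre's theorem on `n * T ^ 2 = x ^ 2 + p * y ^ 2`. -/
theorem exists_mul_sq_eq_sq_add_prime_mul_sq (n p : ℕ) (hn : 0 < n) (hp : p.Prime)
    (hnp : n ∣ p + 1) (hcop : n.Coprime p) (s : ℤ) (hs : (p : ℤ) ∣ s ^ 2 - n) :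
    ∃ (T : ℕ) (x y : ℤ), 0 < T ∧ (n : ℤ) * (T : ℤ) ^ 2 = x ^ 2 + p * y ^ 2 := by
  obtain ⟨x, y, t, hne, hxy, hxt, hx, hy, ht⟩ := exists_small_solution n p hn hp.pos s
  have hp0 : (0 : ℤ) < p := by exact_mod_cast hp.pos
  have hn0 : (0 : ℤ) < n := by exact_mod_cast hn
  have hpZ : Prime (p : ℤ) := Nat.prime_iff_prime_int.1 hp
  have hdvd : (n * p : ℤ) ∣ x ^ 2 + p * y ^ 2 - n * t ^ 2 := by
    refine IsCoprime.mul_dvd (Nat.isCoprime_iff_coprime.2 hcop) ?_ ?_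
    · have h : (n : ℤ) ∣ p + 1 := by exact_mod_cast hnp
      have e : x ^ 2 + p * y ^ 2 - n * t ^ 2
          = (x - y) * (x + y) + (p + 1) * y ^ 2 - n * t ^ 2 := by ring
      rw [e]
      exact ((hxy.mul_right _).add (h.mul_right _)).sub (dvd_mul_right _ _)
    · have e : x ^ 2 + p * y ^ 2 - n * t ^ 2
          = (x - s * t) * (x + s * t) + p * y ^ 2 + (s ^ 2 - n) * t ^ 2 := by ring
      rw [e]
      exact ((hxt.mul_right _).add (dvd_mul_right _ _)).add (hs.mul_right _)
  obtain ⟨k, hk⟩ := hdvd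
  have hk1 : -1 ≤ k := by
    by_contra! hlt
    nlinarith [mul_pos hn0 hp0, sq_nonneg x, mul_nonneg hp0.le (sq_nonneg y)]
  have hk2 : k ≤ 2 := by
    by_contra! hlt
    nlinarith [mul_pos hn0 hp0, mul_nonneg hn0.le (sq_nonneg t)]
  have sq_ne (t : ℤ) : t ^ 2 ≠ p := fun h ↦ by
    have : IsSquare (p : ℤ) := ⟨t, by rw [← h]; ring⟩
    exact hpZ.not_isSquare this
  interval_cases k
  · exfalso
    refine sq_ne t (le_antisymm ht ?_)
    nlinarith [sq_nonneg x, mul_nonneg hp0.le (sq_nonneg y)]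
  · refine ⟨t.natAbs, x, y, ?_, ?_⟩
    · rw [Int.natAbs_pos]
      rintro rfl
      have hx0 : x = 0 := by
        rw [← sq_eq_zero_iff]; nlinarith [sq_nonneg x, mul_nonneg hp0.le (sq_nonneg y)]
      subst hx0
      have hy0 : y = 0 := by
        have : (p : ℤ) * y ^ 2 = 0 := by linarith
        simpa [hp.ne_zero] using this
      simp_all
    · rw [Int.natCast_natAbs, sq_abs]; linarith
  · refine ⟨t.natAbs ^ 2 + p, x * t - p * y, x + y * t, by have := hp.pos; positivity, ?_⟩
    push_cast
    rw [sq_abs]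
    linear_combination (-(t ^ 2 + p : ℤ)) * hk
  · exfalso
    have hx' : x ^ 2 = n * p := by nlinarith [mul_nonneg hn0.le (sq_nonneg t)]
    have hpx : (p : ℤ) ∣ x := hpZ.dvd_of_dvd_pow (hx' ▸ dvd_mul_left _ _)
    obtain ⟨q, rfl⟩ := hpx
    have : (n : ℤ) = p * q ^ 2 := mul_right_cancel₀ hp0.ne' (by linear_combination -hx')
    have hpn : p ∣ n := by exact_mod_cast Dvd.intro _ this.symm
    exact hp.one_lt.ne' (Nat.eq_one_of_dvd_coprimes hcop hpn dvd_rfl)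

theorem sum_three_sq_of_mod_four_eq_two (n : ℕ) (hn : n % 4 = 2) :
    ∃ a b c : ℤ, (n : ℤ) = a ^ 2 + b ^ 2 + c ^ 2 := by
  have hcop1 : (n - 1).Coprime n := by
    rw [Nat.coprime_self_sub_left (by lia)]; simp
  have hcop : (n - 1).Coprime (4 * n) := by
    refine Nat.Coprime.mul_right ?_ hcop1
    have : (n - 1).Coprime (2 ^ 2) :=
      Nat.Coprime.pow_right 2 (Nat.coprime_two_right.2 (by rw [Nat.odd_iff]; lia))
    simpa using this
  obtain ⟨p, hgt, hp, hmod⟩ :=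
    Nat.forall_exists_prime_gt_and_modEq (n - 1) (q := 4 * n) (a := n - 1) (by lia) hcop
  obtain ⟨v, hv⟩ := (Nat.modEq_iff_dvd' hgt.le).1 hmod.symm
  obtain ⟨d, hd⟩ : ∃ d, d = 4 * v + 1 := ⟨_, rfl⟩
  have hdn : d * n = p + 1 := by rw [hd]; lia
  have : Fact p.Prime := ⟨hp⟩
  have hp4 : p % 4 = 1 := by
    have : p = 4 * (n * v) + (n - 1) := by lia
    lia
  have hJ : jacobiSym d p = 1 := by
    rw [jacobiSym.quadratic_reciprocity_one_mod_four (by lia) (by rw [Nat.odd_iff]; lia),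
      jacobiSym.mod_left' (a₂ := -1), jacobiSym.at_neg_one (by rw [Nat.odd_iff]; lia),
      ZMod.χ₄_nat_one_mod_four (by lia)]
    refine Int.ModEq.symm ((Int.modEq_iff_dvd).2 ⟨n, ?_⟩)
    have : (d : ℤ) * n = p + 1 := by exact_mod_cast hdn
    linarith
  obtain ⟨r, hr⟩ := ZMod.isSquare_of_jacobiSym_eq_one hJ
  have hdn' : (d : ZMod p) * n = 1 := by
    have : ((d * n : ℕ) : ZMod p) = ((p + 1 : ℕ) : ZMod p) := by rw [hdn]
    simpa using this
  obtain ⟨s, hs⟩ := ZMod.intCast_surjective (r * (n : ZMod p))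
  have hs' : (p : ℤ) ∣ s ^ 2 - n := by
    rw [← ZMod.intCast_zmod_eq_zero_iff_dvd]
    push_cast
    rw [hs]
    push_cast at hr
    linear_combination (-(n : ZMod p) ^ 2) * hr + (n : ZMod p) * hdn'
  have hnp : n ∣ p + 1 := ⟨d, by rw [← hdn]; ring⟩
  have hnpc : n.Coprime p := by
    refine Nat.Coprime.coprime_dvd_left hnp ?_
    simp
  obtain ⟨T, x, y, hT, h⟩ :=
    exists_mul_sq_eq_sq_add_prime_mul_sq n p (by lia) hp hnp hnpc s hs'
  obtain ⟨a, b, hab⟩ := Nat.Prime.sq_add_sq (p := p) (by lia)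
  refine sum_three_sq_of_mul_sq n T hT x (a * y) (b * y) ?_
  rw [h, ← hab]; push_cast; ring

theorem eq_sq_add_two_mul_sq_add_three_mul_sq_of_three_mul {n r s t : ℤ}
    (h : 3 * n = s ^ 2 + t ^ 2 + 2 * r ^ 2) :
    ∃ a b c : ℤ, n = a ^ 2 + 2 * b ^ 2 + 3 * c ^ 2 := by
  have main {s t : ℤ} (h : 3 * n = s ^ 2 + t ^ 2 + 2 * r ^ 2) (ht : 3 ∣ t) (hs : 3 ∣ s + r) :
      ∃ a b c : ℤ, n = a ^ 2 + 2 * b ^ 2 + 3 * c ^ 2 := by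
    obtain ⟨c, rfl⟩ := ht
    obtain ⟨b, hb⟩ := hs
    refine ⟨b - r, b, c, ?_⟩
    obtain rfl : s = 3 * b - r := by linarith
    linarith
  have h3 : (s ^ 2 + t ^ 2 + 2 * r ^ 2) % 3 = 0 := by lia
  have key : (3 ∣ t ∧ (3 ∣ s + r ∨ 3 ∣ -s + r)) ∨ (3 ∣ s ∧ (3 ∣ t + r ∨ 3 ∣ -t + r)) := by
    have hs : s % 3 = 0 ∨ s % 3 = 1 ∨ s % 3 = 2 := by lia
    have ht : t % 3 = 0 ∨ t % 3 = 1 ∨ t % 3 = 2 := by lia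
    have hr : r % 3 = 0 ∨ r % 3 = 1 ∨ r % 3 = 2 := by lia
    rcases hs with hs | hs | hs <;> rcases ht with ht | ht | ht <;>
      rcases hr with hr | hr | hr <;>
      first
      | (exfalso; simp [pow_two, Int.add_emod, Int.mul_emod, hs, ht, hr] at h3; done)
      | lia
  rcases key with ⟨ht, hs | hs⟩ | ⟨hs, ht | ht⟩
  · exact main h ht hs
  · exact main (s := -s) (by linarith [neg_sq s]) ht hs
  · exact main (by linarith) hs ht
  · exact main (s := -t) (t := s) (by linarith [neg_sq t]) hs ht

theorem eq_sq_add_two_mul_sq_add_three_mul_sq_of_odd (n : ℕ) (hn : n % 2 = 1) :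
    ∃ a b c : ℤ, (n : ℤ) = a ^ 2 + 2 * b ^ 2 + 3 * c ^ 2 := by
  obtain ⟨a, b, c, h⟩ := sum_three_sq_of_mod_four_eq_two (6 * n) (by lia)
  push_cast at h
  have main {a b c : ℤ} (h : 6 * (n : ℤ) = a ^ 2 + b ^ 2 + c ^ 2) (hab : 2 ∣ a + b)
      (hc : 2 ∣ c) : ∃ a b c : ℤ, (n : ℤ) = a ^ 2 + 2 * b ^ 2 + 3 * c ^ 2 := by
    obtain ⟨u, hu⟩ := hab
    obtain ⟨r, rfl⟩ := hc
    obtain rfl : b = 2 * u - a := by linarith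
    exact eq_sq_add_two_mul_sq_add_three_mul_sq_of_three_mul (s := u) (t := a - u) (r := r)
      (by linarith)
  have h2 : (a ^ 2 + b ^ 2 + c ^ 2) % 2 = 0 := by lia
  have key : (2 ∣ a + b ∧ 2 ∣ c) ∨ (2 ∣ a + c ∧ 2 ∣ b) ∨ (2 ∣ b + c ∧ 2 ∣ a) := by
    have ha : a % 2 = 0 ∨ a % 2 = 1 := by lia
    have hb : b % 2 = 0 ∨ b % 2 = 1 := by lia
    have hc : c % 2 = 0 ∨ c % 2 = 1 := by lia
    rcases ha with ha | ha <;> rcases hb with hb | hb <;> rcases hc with hc | hc <;>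
      first
      | (exfalso; simp [pow_two, Int.add_emod, Int.mul_emod, ha, hb, hc] at h2; done)
      | lia
  rcases key with ⟨h1, h2⟩ | ⟨h1, h2⟩ | ⟨h1, h2⟩
  · exact main h h1 h2
  · exact main (by linarith) h1 h2
  · exact main (by linarith) h1 h2

theorem stmt_0 (n : ℕ) :
    ∃ x y z w : ℕ, n = x ^ 2 + y ^ 2 + z ^ 2 + w ^ 2 ∧
      ∃ t : ℤ, (x : ℤ) ^ 2 + 8 * y * z = t ^ 2 := by
  induction n using Nat.strong_induction_on with
  | _ n ih =>
    rcases Nat.eq_zero_or_pos n with rfl | hpos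
    · exact ⟨0, 0, 0, 0, by simp, 0, by simp⟩
    have hcases : n % 2 = 1 ∨ n % 4 = 2 ∨ n % 4 = 0 := by lia
    rcases hcases with hn | hn | hn
    · obtain ⟨a, b, c, h⟩ := eq_sq_add_two_mul_sq_add_three_mul_sq_of_odd n hn
      refine ⟨(|b| - |c|).natAbs, b.natAbs + c.natAbs, c.natAbs, a.natAbs, ?_, |b| + 3 * |c|, ?_⟩
      · zify
        rw [h]
        simp only [sq_abs]
        rw [← sq_abs b, ← sq_abs c]
        ring
      · push_cast
        rw [sq_abs]
        ring
    · obtain ⟨a, b, c, h⟩ := sum_three_sq_of_mod_four_eq_two n hn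
      refine ⟨a.natAbs, b.natAbs, 0, c.natAbs, ?_, a, by simp⟩
      zify
      simp [h]
    · obtain ⟨x, y, z, w, h, t, ht⟩ := ih (n / 4) (by lia)
      refine ⟨2 * x, 2 * y, 2 * z, 2 * w, ?_, 2 * t, ?_⟩
      · have : n = 4 * (n / 4) := by lia
        rw [this, h]; ring
      · push_cast
        linear_combination 4 * ht
end

section
/- Every positive integer n can be written as n = x^2 + y^2 + z^2 + w^2 with x, y, z, w nonnegative integers such that x + 2y is a positive perfect square, i.e., x + 2y = t^2 for some positive integer t. -/
open scoped NumberTheorySymbols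

/-- The symmetric matrix with diagonal `a, b, c` and off-diagonal entries `d` (at `(2, 3)`),
`e` (at `(1, 3)`), `f` (at `(1, 2)`) is the Gram matrix of three vectors of `ℤ³`. -/
def IsIntGram (a b c d e f : ℤ) : Prop :=
  ∃ u v w : Fin 3 → ℤ, u ⬝ᵥ u = a ∧ v ⬝ᵥ v = b ∧ w ⬝ᵥ w = c ∧
    v ⬝ᵥ w = d ∧ u ⬝ᵥ w = e ∧ u ⬝ᵥ v = f

namespace IsIntGram

variable {a b c d e f : ℤ}

lemma swap_left (h : IsIntGram b a c e d f) : IsIntGram a b c d e f := by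
  obtain ⟨u, v, w, h1, h2, h3, h4, h5, h6⟩ := h
  exact ⟨v, u, w, h2, h1, h3, h5, h4, by rw [dotProduct_comm, h6]⟩

lemma swap_right (h : IsIntGram a c b d f e) : IsIntGram a b c d e f := by
  obtain ⟨u, v, w, h1, h2, h3, h4, h5, h6⟩ := h
  exact ⟨u, w, v, h1, h3, h2, by rw [dotProduct_comm, h4], h6, h5⟩

lemma of_shear_right (t : ℤ)
    (h : IsIntGram a b (c + 2 * t * d + t ^ 2 * b) (d + t * b) (e + t * f) f) :
    IsIntGram a b c d e f := by
  obtain ⟨u, v, w, h1, h2, h3, h4, h5, h6⟩ := h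
  refine ⟨u, v, w - t • v, h1, h2, ?_, ?_, ?_, h6⟩
  · simp only [dotProduct_sub, sub_dotProduct, dotProduct_smul, smul_dotProduct, h2, h3, h4,
      dotProduct_comm w v, smul_eq_mul]
    ring
  · simp only [dotProduct_sub, dotProduct_smul, h2, h4, smul_eq_mul]
    ring
  · simp only [dotProduct_sub, dotProduct_smul, h5, h6, smul_eq_mul]
    ring

lemma of_shear_left (s : ℤ)
    (h : IsIntGram a (b + 2 * s * f + s ^ 2 * a) c (d + s * e) e (f + s * a)) :
    IsIntGram a b c d e f :=
  h.swap_right.swap_left |>.of_shear_right s |>.swap_left.swap_right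

end IsIntGram

lemma exists_abs_two_mul_add_mul_le {g : ℤ} (hg : 0 < g) (h : ℤ) :
    ∃ t : ℤ, |2 * (h + t * g)| ≤ g := by
  refine ⟨-((2 * h + g) / (2 * g)), ?_⟩
  have h1 := Int.mul_ediv_add_emod (2 * h + g) (2 * g)
  have h2 := Int.emod_nonneg (2 * h + g) (by positivity : 2 * g ≠ 0)
  have h3 := Int.emod_lt_of_pos (2 * h + g) (by positivity : 0 < 2 * g)
  rw [abs_le]
  constructor <;> linarith

lemma isIntGram_of_reduced {a b c d e f : ℤ} (ha : 0 < a) (hg : 0 < a * b - f ^ 2)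
    (hdet : a * b * c + 2 * d * e * f - a * d ^ 2 - b * e ^ 2 - c * f ^ 2 = 1)
    (hab : a ≤ b) (hf : |2 * f| ≤ a) (hgk : a * b - f ^ 2 ≤ a * c - e ^ 2)
    (hh : |2 * (a * d - e * f)| ≤ a * b - f ^ 2) : IsIntGram a b c d e f := by
  have hgram : (a * b - f ^ 2) * (a * c - e ^ 2) = a + (a * d - e * f) ^ 2 := by
    linear_combination a * hdet
  set g := a * b - f ^ 2 with hgdef
  set h := a * d - e * f with hhdef
  have hh2 : (2 * h) ^ 2 ≤ g ^ 2 := sq_le_sq' (abs_le.1 hh).1 (abs_le.1 hh).2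
  have hf2 : (2 * f) ^ 2 ≤ a ^ 2 := sq_le_sq' (abs_le.1 hf).1 (abs_le.1 hf).2
  have h1 : 3 * g ^ 2 ≤ 4 * a := by nlinarith
  have h2 : 3 * a ^ 2 ≤ 4 * g := by nlinarith
  have ha1 : a = 1 := by
    by_contra hne
    have : 2 ≤ a := by omega
    nlinarith [mul_self_nonneg (a - g)]
  have hg1 : g = 1 := by nlinarith
  subst ha1
  rw [hg1] at hh
  have hf0 : f = 0 := by rw [abs_le] at hf; omega
  have hh0 : h = 0 := by rw [abs_le] at hh; omega
  subst hf0
  have hd : d = 0 := by linarith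
  have hb : b = 1 := by linarith
  subst hd hb
  have hc : c = 1 + e ^ 2 := by linarith
  subst hc
  refine ⟨![1, 0, 0], ![0, 1, 0], ![e, 0, 1], ?_⟩
  simp
  ring

/-- Every positive definite integral ternary form of determinant one is a sum of three squares of
integral linear forms. -/
theorem isIntGram_of_det_eq_one (a b c d e f : ℤ) (ha : 0 < a) (hg : 0 < a * b - f ^ 2)
    (hdet : a * b * c + 2 * d * e * f - a * d ^ 2 - b * e ^ 2 - c * f ^ 2 = 1) :
    IsIntGram a b c d e f := by
  obtain ⟨t, ht⟩ := exists_abs_two_mul_add_mul_le hg (a * d - e * f)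
  obtain ⟨s, hs⟩ := exists_abs_two_mul_add_mul_le ha f
  refine .of_shear_right t (.of_shear_left s ?_)
  have hg' : a * (b + 2 * s * f + s ^ 2 * a) - (f + s * a) ^ 2 = a * b - f ^ 2 := by ring
  have hh' : a * (d + t * b + s * (e + t * f)) - (e + t * f) * (f + s * a) =
      a * d - e * f + t * (a * b - f ^ 2) := by ring
  have hdet' : a * (b + 2 * s * f + s ^ 2 * a) * (c + 2 * t * d + t ^ 2 * b) +
      2 * (d + t * b + s * (e + t * f)) * (e + t * f) * (f + s * a) -
      a * (d + t * b + s * (e + t * f)) ^ 2 - (b + 2 * s * f + s ^ 2 * a) * (e + t * f) ^ 2 -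
      (c + 2 * t * d + t ^ 2 * b) * (f + s * a) ^ 2 = 1 := by
    linear_combination hdet
  rw [← hg'] at hg
  rw [← hh', ← hg'] at ht
  have hdec : (a * (b + 2 * s * f + s ^ 2 * a) - (f + s * a) ^ 2).toNat =
      (a * b - f ^ 2).toNat := by rw [hg']
  generalize b + 2 * s * f + s ^ 2 * a = b' at *
  generalize c + 2 * t * d + t ^ 2 * b = c' at *
  generalize d + t * b + s * (e + t * f) = d' at *
  generalize e + t * f = e' at *
  generalize f + s * a = f' at *
  have hb' : 0 < b' := by nlinarith [sq_nonneg f']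
  have hgram : (a * b' - f' ^ 2) * (a * c' - e' ^ 2) = a + (a * d' - e' * f') ^ 2 := by
    linear_combination a * hdet'
  by_cases hk : a * c' - e' ^ 2 < a * b' - f' ^ 2
  · have hk0 : 0 < a * c' - e' ^ 2 := by
      refine pos_of_mul_pos_right ?_ hg.le
      rw [hgram]
      positivity
    exact .swap_right (isIntGram_of_det_eq_one a c' b' d' f' e' ha hk0 (by linarith))
  by_cases hba : b' < a
  · exact .swap_left (isIntGram_of_det_eq_one b' a c' e' d' f' hb' (by linarith) (by linarith))
  exact isIntGram_of_reduced ha hg hdet' (not_lt.1 hba) hs (not_lt.1 hk) ht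
termination_by (a.toNat, (a * b - f ^ 2).toNat)
decreasing_by
  · rw [← hdec]
    exact Prod.Lex.right _ (by omega)
  · exact Prod.Lex.left _ _ (by omega)

/-- `n` is a sum of three squares. -/
def IsSumThreeSq (n : ℕ) : Prop := ∃ x y z : ℕ, n = x ^ 2 + y ^ 2 + z ^ 2

lemma IsSumThreeSq.mul_sq {n : ℕ} (h : IsSumThreeSq n) (k : ℕ) : IsSumThreeSq (k ^ 2 * n) := by
  obtain ⟨x, y, z, rfl⟩ := h
  exact ⟨k * x, k * y, k * z, by ring⟩

lemma isSumThreeSq_of_dvd {n D m : ℕ} (hD : 0 < D) (hm : 0 < m) (hn : m + 1 = D * n) {x : ℤ}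
    (hx : (m : ℤ) ∣ x ^ 2 + D) : IsSumThreeSq n := by
  obtain ⟨a, ha⟩ := hx
  zify at hD hm hn
  have ha0 : 0 < a := by
    refine pos_of_mul_pos_right (a := (m : ℤ)) ?_ hm.le
    rw [← ha]
    positivity
  obtain ⟨-, -, w, -, -, hw, -⟩ := isIntGram_of_det_eq_one a m n 0 1 x ha0
    (by linarith) (by linear_combination (-n : ℤ) * ha - hn)
  refine ⟨(w 0).natAbs, (w 1).natAbs, (w 2).natAbs, ?_⟩
  rw [Matrix.vec3_dotProduct] at hw
  zify
  simp only [sq_abs]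
  linarith

lemma exists_dvd_sq_add_of_jacobiSym {p D : ℕ} (hp : p.Prime) (h : J(-D | p) = 1) :
    ∃ x : ℤ, (p : ℤ) ∣ x ^ 2 + D := by
  have := Fact.mk hp
  obtain ⟨y, hy⟩ := ZMod.isSquare_of_jacobiSym_eq_one h
  obtain ⟨x, rfl⟩ := ZMod.intCast_surjective y
  refine ⟨x, (ZMod.intCast_zmod_eq_zero_iff_dvd _ p).1 ?_⟩
  push_cast at hy ⊢
  linear_combination -hy

lemma isSumThreeSq_of_mod_four_eq_two {n : ℕ} (hn : n % 4 = 2) : IsSumThreeSq n := by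
  have hcop : (n - 1).Coprime (4 * n) := by
    refine Nat.Coprime.mul_right ?_ ?_
    · exact Nat.Coprime.pow_right 2 (Nat.coprime_two_right.2 (Nat.odd_iff.2 (by omega)))
    · have := Nat.coprime_self_sub_left (m := 1) (n := n) (by omega)
      rw [this]; simp
  obtain ⟨p, hlt, hp, hmod⟩ :=
    Nat.forall_exists_prime_gt_and_modEq n (q := 4 * n) (by omega) hcop
  obtain ⟨j, hj⟩ := (Nat.modEq_iff_dvd' (by omega)).1 hmod.symm
  have hD : p + 1 = (4 * j + 1) * n := by
    have : p = 4 * n * j + (n - 1) := by omega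
    rw [this]
    zify [show 1 ≤ n by omega]
    ring
  have hp4 : p % 4 = 1 := by
    have : p = 4 * (n * j) + (n - 1) := by rw [← mul_assoc]; omega
    omega
  have hpD : (p : ℤ) % (4 * j + 1 : ℕ) = (-1 : ℤ) % (4 * j + 1 : ℕ) := by
    refine Int.ModEq.symm <| Int.modEq_iff_dvd.2 ⟨n, ?_⟩
    zify at hD
    push_cast
    linarith
  have hJ : J(-(4 * j + 1 : ℕ) | p) = 1 := by
    rw [jacobiSym.neg _ (Nat.odd_iff.2 (by omega)), ZMod.χ₄_nat_one_mod_four hp4, one_mul,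
      jacobiSym.quadratic_reciprocity_one_mod_four (by omega) (Nat.odd_iff.2 (by omega)),
      jacobiSym.mod_left' hpD, jacobiSym.at_neg_one (Nat.odd_iff.2 (by omega)),
      ZMod.χ₄_nat_one_mod_four (by omega)]
  obtain ⟨x, hx⟩ := exists_dvd_sq_add_of_jacobiSym hp hJ
  exact isSumThreeSq_of_dvd (by omega) hp.pos hD hx

lemma isSumThreeSq_of_odd {n : ℕ} (hn : n % 8 = 1 ∨ n % 8 = 3 ∨ n % 8 = 5) :
    IsSumThreeSq n := by
  obtain ⟨c, hc, hcn⟩ : ∃ c : ℕ, (c = 1 ∨ c = 3) ∧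
      ((c * n) % 8 = 3 ∨ (c * n) % 8 = 7 ∧ c = 3) := by
    rcases hn with h | h | h
    · exact ⟨3, by omega⟩
    · exact ⟨1, by omega⟩
    · exact ⟨3, by omega⟩
  obtain ⟨r, hr⟩ : ∃ r, c * n = 2 * r + 1 := ⟨(c * n) / 2, by omega⟩
  have hcop : r.Coprime (4 * n) := by
    refine Nat.Coprime.mul_right ?_ ?_
    · exact Nat.Coprime.pow_right 2 (Nat.coprime_two_right.2 (Nat.odd_iff.2 (by omega)))
    · rw [← Nat.isCoprime_iff_coprime]
      exact ⟨-2, c, by zify at hr; linarith⟩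
  obtain ⟨p, hlt, hp, hmod⟩ :=
    Nat.forall_exists_prime_gt_and_modEq (r + 2) (q := 4 * n) (by omega) hcop
  obtain ⟨j, hj⟩ := (Nat.modEq_iff_dvd' (by omega)).1 hmod.symm
  have hpj : p = 4 * (n * j) + r := by rw [← mul_assoc]; omega
  have hD : 2 * p + 1 = (8 * j + c) * n := by
    rw [hpj]
    linarith
  have hDmod : (8 * j + c) % 8 = c := by omega
  generalize 8 * j + c = D at hD hDmod
  have hDodd : Odd D := Nat.odd_iff.2 (by omega)
  have hJ2 : J(-2 | D) = 1 := by
    rw [jacobiSym.at_neg_two hDodd, ZMod.χ₈'_nat_eq_if_mod_eight]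
    rcases hc with rfl | rfl <;> simp [hDmod] <;> omega
  have hJ' : J(p | D) = 1 := by
    have h : J(-2 * p | D) = J(1 | D) := by
      refine jacobiSym.mod_left' (Int.modEq_iff_dvd.2 ⟨n, ?_⟩)
      zify at hD
      linarith
    rwa [jacobiSym.mul_left, hJ2, one_mul, jacobiSym.one_left] at h
  have hJ : J(-D | p) = 1 := by
    rw [jacobiSym.neg _ (Nat.odd_iff.2 (by omega))]
    rcases hcn with h | ⟨h, rfl⟩
    · have hp4 : p % 4 = 1 := by omega
      rw [ZMod.χ₄_nat_one_mod_four hp4, one_mul,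
        jacobiSym.quadratic_reciprocity_one_mod_four' hDodd hp4, hJ']
    · have hp4 : p % 4 = 3 := by omega
      rw [ZMod.χ₄_nat_three_mod_four hp4,
        jacobiSym.quadratic_reciprocity_three_mod_four (by omega) hp4, hJ']
      norm_num
  obtain ⟨y, hy⟩ := exists_dvd_sq_add_of_jacobiSym hp hJ
  have hpodd : Odd (p : ℤ) := by exact_mod_cast Nat.odd_iff.2 (by omega)
  have hDodd' : Odd (D : ℤ) := by exact_mod_cast hDodd
  obtain ⟨x, hx, hxodd⟩ : ∃ x : ℤ, (p : ℤ) ∣ x ^ 2 + D ∧ Odd x := by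
    rcases Int.even_or_odd y with h | h
    · refine ⟨y + p, ?_, h.add_odd hpodd⟩
      rw [show (y + p) ^ 2 + (D : ℤ) = y ^ 2 + D + p * (2 * y + p) by ring]
      exact dvd_add hy (dvd_mul_right _ _)
    · exact ⟨y, hy, h⟩
  have hx2 : (2 : ℤ) ∣ x ^ 2 + D := (hxodd.pow.add_odd hDodd').two_dvd
  have hcop2 : IsCoprime (2 : ℤ) p := Int.isCoprime_two_left.2 hpodd
  exact isSumThreeSq_of_dvd (m := 2 * p) hDodd.pos (by have := hp.pos; omega) hD
    (by exact_mod_cast hcop2.mul_dvd hx2 hx)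

lemma five_dvd_sub_or_add {p q : ℤ} (h : 5 ∣ p ^ 2 + q ^ 2) : 5 ∣ p - 2 * q ∨ 5 ∣ p + 2 * q := by
  refine (Int.prime_iff_natAbs_prime.2 (by norm_num)).dvd_or_dvd ?_
  rw [show (p - 2 * q) * (p + 2 * q) = p ^ 2 + q ^ 2 - 5 * q ^ 2 by ring]
  exact dvd_sub h (dvd_mul_right _ _)

lemma exists_five_dvd_sub {p q : ℤ} (h : 5 ∣ p ^ 2 + q ^ 2) :
    ∃ r : ℤ, r ^ 2 = p ^ 2 ∧ 5 ∣ r - 2 * q := by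
  rcases five_dvd_sub_or_add h with h | h
  · exact ⟨p, rfl, h⟩
  · exact ⟨-p, by ring, by rw [← dvd_neg]; simpa [add_comm] using h⟩

lemma sq_emod_five (a : ℤ) : a ^ 2 % 5 = 0 ∨ a ^ 2 % 5 = 1 ∨ a ^ 2 % 5 = 4 := by
  have : a % 5 = 0 ∨ a % 5 = 1 ∨ a % 5 = 2 ∨ a % 5 = 3 ∨ a % 5 = 4 := by omega
  rcases this with h | h | h | h | h <;> simp [pow_two, Int.mul_emod, h]

/-- If a sum of three squares is minus a fourth power modulo `5`, then two of the three squares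
have a sum divisible by `5`. -/
lemma exists_sq_add_sq_dvd_five {a b c t : ℤ} (h : 5 ∣ a ^ 2 + b ^ 2 + c ^ 2 + t ^ 4) :
    ∃ u p q : ℤ, a ^ 2 + b ^ 2 + c ^ 2 = u ^ 2 + p ^ 2 + q ^ 2 ∧ 5 ∣ p ^ 2 + q ^ 2 := by
  have ht : t ^ 4 % 5 = 0 ∨ t ^ 4 % 5 = 1 := by
    rw [show t ^ 4 = t ^ 2 * t ^ 2 by ring, Int.mul_emod]
    rcases sq_emod_five t with h | h | h <;> simp [h]
  have key : 5 ∣ b ^ 2 + c ^ 2 ∨ 5 ∣ a ^ 2 + c ^ 2 ∨ 5 ∣ a ^ 2 + b ^ 2 := by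
    have ha := sq_emod_five a
    have hb := sq_emod_five b
    have hc := sq_emod_five c
    omega
  rcases key with h | h | h
  · exact ⟨a, b, c, rfl, h⟩
  · exact ⟨b, a, c, by ring, h⟩
  · exact ⟨c, a, b, by ring, h⟩

lemma exists_of_isSumThreeSq {n t : ℕ} (ht : 0 < t) (hle : 4 * n ≤ t ^ 4) (hge : t ^ 4 ≤ 5 * n)
    (h : IsSumThreeSq (5 * n - t ^ 4)) :
    ∃ x y z w : ℕ, n = x ^ 2 + y ^ 2 + z ^ 2 + w ^ 2 ∧
      ∃ t : ℤ, 0 < t ∧ (x : ℤ) + 2 * y = t ^ 2 := by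
  obtain ⟨a, b, c, h⟩ := h
  zify [hge] at h hle ht
  obtain ⟨u, p, q, hsum, hpq⟩ := exists_sq_add_sq_dvd_five (a := a) (b := b) (c := c) (t := t)
    ⟨n, by linarith⟩
  obtain ⟨p, hp, v, hv⟩ := exists_five_dvd_sub hpq
  rw [← hp] at hsum hpq
  obtain ⟨u, hu, y, hy⟩ := exists_five_dvd_sub (p := u) (q := (t : ℤ) ^ 2)
    (by obtain ⟨m, hm⟩ := hpq; exact ⟨n - m, by linarith⟩)
  rw [← hu] at hsum
  have hu4 : (2 * u) ^ 2 ≤ ((t : ℤ) ^ 2) ^ 2 := by nlinarith [sq_nonneg p, sq_nonneg q]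
  obtain ⟨h1, h2⟩ := abs_le.1 (abs_le_of_sq_le_sq hu4 (by positivity))
  have hx : 0 ≤ (t : ℤ) ^ 2 + 2 * y := by linarith
  have hy0 : 0 ≤ -y := by linarith
  refine ⟨((t : ℤ) ^ 2 + 2 * y).toNat, (-y).toNat, (2 * v + q).natAbs, v.natAbs, ?_, t, ht, ?_⟩
  · zify
    rw [Int.toNat_of_nonneg hx, Int.toNat_of_nonneg hy0, sq_abs, sq_abs]
    obtain rfl : u = 2 * (t : ℤ) ^ 2 + 5 * y := by linarith
    obtain rfl : p = 2 * q + 5 * v := by linarith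
    linarith
  · rw [Int.toNat_of_nonneg hx, Int.toNat_of_nonneg hy0]
    ring

lemma exists_pow_four_mem {n : ℕ} (hn : 420000 ≤ n) (r : ℕ) :
    ∃ t : ℕ, 0 < t ∧ t % 2 = r % 2 ∧ 4 * n ≤ t ^ 4 ∧ t ^ 4 ≤ 5 * n := by
  have hex : ∃ m : ℕ, 4 * n ≤ m ^ 4 := ⟨4 * n, Nat.le_self_pow (by norm_num) _⟩
  obtain ⟨m, hm, hmin⟩ : ∃ m : ℕ, 4 * n ≤ (m + 1) ^ 4 ∧ m ^ 4 < 4 * n := by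
    classical
    have h0 : Nat.find hex ≠ 0 := fun h => by
      have := Nat.find_spec hex
      rw [h] at this
      omega
    obtain ⟨m, hm⟩ := Nat.exists_eq_succ_of_ne_zero h0
    have hspec := Nat.find_spec hex
    rw [hm] at hspec
    exact ⟨m, hspec, not_le.1 (Nat.find_min hex (by omega))⟩
  have hm35 : 35 ≤ m := by
    by_contra! hlt
    have : (m + 1) ^ 4 ≤ 35 ^ 4 := Nat.pow_le_pow_left (by omega) 4
    omega
  have hbound : 4 * (m + 2) ^ 4 ≤ 5 * m ^ 4 := by
    obtain ⟨k, rfl⟩ := Nat.exists_eq_add_of_le hm35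
    ring_nf
    nlinarith [Nat.zero_le (k ^ 2), Nat.zero_le (k ^ 3), Nat.zero_le (k ^ 4)]
  have hmono : (m + 1) ^ 4 ≤ (m + 2) ^ 4 := Nat.pow_le_pow_left (by omega) 4
  rcases (by omega : (m + 1) % 2 = r % 2 ∨ (m + 2) % 2 = r % 2) with h | h
  · exact ⟨m + 1, by omega, h, hm, by omega⟩
  · exact ⟨m + 2, by omega, h, by omega, by omega⟩

/-- The union of the finite sets with binary indicators `g 0, …, g (k - 1)`. -/
def bitUnion (g : ℕ → ℕ) : ℕ → ℕ
  | 0 => 0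
  | k + 1 => bitUnion g k ||| g k

lemma exists_of_testBit_bitUnion {g : ℕ → ℕ} {k i : ℕ} (h : (bitUnion g k).testBit i) :
    ∃ j < k, (g j).testBit i := by
  induction k with
  | zero => simp [bitUnion] at h
  | succ k ih =>
    rw [bitUnion, Nat.testBit_or, Bool.or_eq_true] at h
    rcases h with h | h
    · obtain ⟨j, hj, hij⟩ := ih h
      exact ⟨j, by omega, hij⟩
    · exact ⟨k, by omega, h⟩

lemma exists_add_of_testBit_shiftLeft {S s i : ℕ} (h : (S <<< s).testBit i) :
    ∃ j, S.testBit j ∧ i = j + s := by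
  rw [Nat.testBit_shiftLeft, Bool.and_eq_true, decide_eq_true_eq] at h
  exact ⟨i - s, h.2, by omega⟩

/-- The bits at squares below `649 ^ 2` are set. -/
def squareBits : ℕ := bitUnion (fun z => 1 <<< z ^ 2) 649

/-- The set bits are at sums of two squares. -/
def twoSquareBits : ℕ := bitUnion (fun w => squareBits <<< w ^ 2) 649

/-- The set bits are at sums `x² + y² + z² + w²` with `x + 2 * y = t²` and `1 ≤ t ≤ m`. -/
def representableBits (m : ℕ) : ℕ :=
  bitUnion (fun k => bitUnion (fun y => twoSquareBits <<< (((k + 1) ^ 2 - 2 * y) ^ 2 + y ^ 2))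
    ((k + 1) ^ 2 / 2 + 1)) m

lemma exists_of_testBit_twoSquareBits {i : ℕ} (h : twoSquareBits.testBit i) :
    ∃ z w : ℕ, i = z ^ 2 + w ^ 2 := by
  obtain ⟨w, -, h⟩ := exists_of_testBit_bitUnion h
  obtain ⟨i, hi, rfl⟩ := exists_add_of_testBit_shiftLeft h
  obtain ⟨z, -, hz⟩ := exists_of_testBit_bitUnion hi
  obtain ⟨j, hj, rfl⟩ := exists_add_of_testBit_shiftLeft hz
  rw [Nat.testBit_one_eq_true_iff_self_eq_zero] at hj
  exact ⟨z, w, by rw [hj, zero_add]⟩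

lemma exists_of_testBit_representableBits {n m : ℕ} (h : (representableBits m).testBit n) :
    ∃ x y z w : ℕ, n = x ^ 2 + y ^ 2 + z ^ 2 + w ^ 2 ∧
      ∃ t : ℤ, 0 < t ∧ (x : ℤ) + 2 * y = t ^ 2 := by
  obtain ⟨k, -, h⟩ := exists_of_testBit_bitUnion h
  obtain ⟨y, hy, h⟩ := exists_of_testBit_bitUnion h
  obtain ⟨i, hi, rfl⟩ := exists_add_of_testBit_shiftLeft h
  obtain ⟨z, w, rfl⟩ := exists_of_testBit_twoSquareBits hi
  refine ⟨(k + 1) ^ 2 - 2 * y, y, z, w, by ring, k + 1, by positivity, ?_⟩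
  zify [show 2 * y ≤ (k + 1) ^ 2 by omega]
  ring

lemma representableBits_mod_two_pow :
    (representableBits 32 ||| 1) % 2 ^ 420000 = 2 ^ 420000 - 1 := by
  decide +kernel

lemma exists_of_lt {n : ℕ} (hn : 0 < n) (hlt : n < 420000) :
    ∃ x y z w : ℕ, n = x ^ 2 + y ^ 2 + z ^ 2 + w ^ 2 ∧
      ∃ t : ℤ, 0 < t ∧ (x : ℤ) + 2 * y = t ^ 2 := by
  have h := congrArg (Nat.testBit · n) representableBits_mod_two_pow
  simp only [Nat.testBit_mod_two_pow, Nat.testBit_two_pow_sub_one, hlt, decide_true,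
    Bool.true_and, Nat.testBit_or, Bool.or_eq_true] at h
  rcases h with h | h
  · exact exists_of_testBit_representableBits h
  · rw [Nat.testBit_one_eq_true_iff_self_eq_zero] at h
    omega

lemma exists_of_ge {n : ℕ} (hge : 420000 ≤ n) (h16 : n % 16 ≠ 0) :
    ∃ x y z w : ℕ, n = x ^ 2 + y ^ 2 + z ^ 2 + w ^ 2 ∧
      ∃ t : ℤ, 0 < t ∧ (x : ℤ) + 2 * y = t ^ 2 := by
  by_cases hodd : n % 8 = 3 ∨ n % 8 = 4
  · obtain ⟨t, ht, htr, hle, hge⟩ := exists_pow_four_mem hge 1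
    refine exists_of_isSumThreeSq ht hle hge ?_
    have ht8 : t ^ 4 % 8 = 1 := by
      rw [Nat.pow_mod]
      rcases (by omega : t % 8 = 1 ∨ t % 8 = 3 ∨ t % 8 = 5 ∨ t % 8 = 7) with h | h | h | h <;>
        simp [h]
    rcases hodd with h | h
    · exact isSumThreeSq_of_mod_four_eq_two (by omega)
    · exact isSumThreeSq_of_odd (by omega)
  · obtain ⟨t, ht, htr, hle, hge⟩ := exists_pow_four_mem hge 0
    refine exists_of_isSumThreeSq ht hle hge ?_
    have ht16 : t ^ 4 % 16 = 0 := by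
      obtain ⟨s, rfl⟩ : 2 ∣ t := by omega
      rw [mul_pow]
      omega
    by_cases h8 : n % 16 = 8
    · rw [show 5 * n - t ^ 4 = 2 ^ 2 * ((5 * n - t ^ 4) / 4) by omega]
      exact (isSumThreeSq_of_mod_four_eq_two (by omega)).mul_sq 2
    by_cases h2 : n % 4 = 2
    · exact isSumThreeSq_of_mod_four_eq_two (by omega)
    · have : n % 8 = 1 ∨ n % 8 = 5 ∨ n % 8 = 7 := by omega
      exact isSumThreeSq_of_odd (by omega)

theorem stmt_1 (n : ℕ) (hn : 0 < n) :
    ∃ x y z w : ℕ, n = x ^ 2 + y ^ 2 + z ^ 2 + w ^ 2 ∧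
      ∃ t : ℤ, 0 < t ∧ (x : ℤ) + 2 * y = t ^ 2 := by
  induction n using Nat.strong_induction_on with
  | _ n ih =>
    rcases lt_or_ge n 420000 with hlt | hge
    · exact exists_of_lt hn hlt
    by_cases h16 : n % 16 = 0
    · obtain ⟨x, y, z, w, h, t, ht, hxy⟩ := ih (n / 16) (by omega) (by omega)
      refine ⟨4 * x, 4 * y, 4 * z, 4 * w, ?_, 2 * t, by positivity, ?_⟩
      · rw [show n = 16 * (n / 16) by omega, h]
        ring
      · push_cast
        linear_combination 4 * hxy
    · exact exists_of_ge hge h16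
end

section
/- For every natural number n the following four claims all hold: (1) there exist integers x, y, z, w with n = x^2 + y^2 + z^2 + w^2 and (x - y)(x + 2y + 2z) = 0; (2) there exist integers x, y, z, w with n = x^2 + y^2 + z^2 + w^2 and (x - 2y)(x + 2y + 2z) = 0; (3) there exist integers x, y, z, w with n = x^2 + y^2 + z^2 + w^2 and (x + y - z)(x + 2y + 2z) = 0; (4) there exist integers x, y, z, w with n = x^2 + y^2 + z^2 + w^2 and (x + y - 2z)(x + 2y + 2z) = 0. -/
/-- An integer that is a sum of three integer squares. -/
def IsSumThreeSquares (n : ℤ) : Prop :=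
  ∃ a b c : ℤ, n = a ^ 2 + b ^ 2 + c ^ 2

theorem exists_abs_two_mul_add_mul_le_s2 (c : ℤ) {m : ℤ} (hm : 0 < m) :
    ∃ k : ℤ, |2 * (c + k * m)| ≤ m := by
  refine ⟨-((2 * c + m) / (2 * m)), ?_⟩
  have h₁ := Int.emod_add_mul_ediv (2 * c + m) (2 * m)
  have h₂ := Int.emod_nonneg (2 * c + m) (by omega : 2 * m ≠ 0)
  have h₃ := Int.emod_lt_of_pos (2 * c + m) (by omega : 0 < 2 * m)
  rw [abs_le]
  constructor <;> nlinarith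

theorem eq_one_of_three_mul_sq_le {a B : ℤ} (ha : 0 < a) (hB : 0 < B)
    (h₁ : 3 * B ^ 2 ≤ 4 * a) (h₂ : 3 * a ^ 2 ≤ 4 * B) : a = 1 ∧ B = 1 := by
  have h : a + B ≤ 2 := by nlinarith [sq_nonneg (a - B)]
  omega

/-- A positive definite integral ternary quadratic form of determinant one represents only
sums of three squares. -/
theorem isSumThreeSquares_ternary_form (a b c r s t : ℤ) (ha : 0 < a) (hB : 0 < a * b - t ^ 2)
    (hdet : a * b * c + 2 * r * s * t - a * r ^ 2 - b * s ^ 2 - c * t ^ 2 = 1) (x y z : ℤ) :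
    IsSumThreeSquares (a * x ^ 2 + b * y ^ 2 + c * z ^ 2 + 2 * r * y * z + 2 * s * x * z +
      2 * t * x * y) := by
  obtain ⟨k, hk⟩ := exists_abs_two_mul_add_mul_le_s2 (a * r - t * s) hB
  obtain ⟨l, hl⟩ := exists_abs_two_mul_add_mul_le_s2 t ha
  obtain ⟨r', hr'⟩ : ∃ r', r' = r + k * b := ⟨_, rfl⟩
  obtain ⟨s', hs'⟩ : ∃ s', s' = s + k * t := ⟨_, rfl⟩
  obtain ⟨c', hc'⟩ : ∃ c', c' = c + 2 * k * r + k ^ 2 * b := ⟨_, rfl⟩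
  have hC : a * r - t * s + k * (a * b - t ^ 2) = a * r' - t * s' := by subst hr' hs'; ring
  rw [hC] at hk
  have hdet' : a * b * c' + 2 * r' * s' * t - a * r' ^ 2 - b * s' ^ 2 - c' * t ^ 2 = 1 := by
    subst hr' hs' hc'; linear_combination hdet
  have hBD : (a * b - t ^ 2) * (a * c' - s' ^ 2) = a + (a * r' - t * s') ^ 2 := by
    linear_combination a * hdet'
  have hD : 0 < a * c' - s' ^ 2 := by
    refine pos_of_mul_pos_right ?_ hB.le
    rw [hBD]; positivity
  by_cases hlt : a * c' - s' ^ 2 < a * b - t ^ 2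
  · have := isSumThreeSquares_ternary_form a c' b r' t s' ha hD
      (by linear_combination hdet') x z (y - k * z)
    convert this using 1
    subst hr' hs' hc'; ring
  obtain ⟨t', ht'⟩ : ∃ t', t' = t + l * a := ⟨_, rfl⟩
  obtain ⟨b', hb'⟩ : ∃ b', b' = b + 2 * l * t + l ^ 2 * a := ⟨_, rfl⟩
  obtain ⟨q, hq⟩ : ∃ q, q = r' + l * s' := ⟨_, rfl⟩
  rw [← ht'] at hl
  have hab : a * b' = (a * b - t ^ 2) + t' ^ 2 := by subst ht' hb'; ring
  have hb'pos : 0 < b' := by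
    refine pos_of_mul_pos_right ?_ ha.le
    rw [hab]; positivity
  by_cases hlt' : b' < a
  · have := isSumThreeSquares_ternary_form b' a c' s' q t' hb'pos
      (by linarith [mul_comm a b'])
      (by subst hq ht' hb'; linear_combination hdet') (y - k * z) (x - l * (y - k * z)) z
    convert this using 1
    subst hq ht' hb' hr' hs' hc'; ring
  have hk2 := sq_le_sq' (abs_le.mp hk).1 (abs_le.mp hk).2
  have hl2 := sq_le_sq' (abs_le.mp hl).1 (abs_le.mp hl).2
  obtain ⟨B, hBdef⟩ : ∃ B, B = a * b - t ^ 2 := ⟨_, rfl⟩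
  rw [← hBdef] at *
  obtain ⟨ha1, hB1⟩ := eq_one_of_three_mul_sq_le ha hB (by nlinarith) (by nlinarith)
  subst ha1
  refine ⟨x + t * y + s * z, y + (r - t * s) * z, z, ?_⟩
  have hb : b = 1 + t ^ 2 := by linarith
  subst hb
  linear_combination z ^ 2 * hdet
termination_by (a.toNat, (a * b - t ^ 2).toNat)
decreasing_by
  · exact Prod.Lex.right _ (by omega)
  · exact Prod.Lex.left _ _ (by omega)

theorem isSumThreeSquares_of_dvd_sq_add {n d u : ℤ} (hd : 0 < d) (hq : 0 < d * n - 1)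
    (h : d * n - 1 ∣ u ^ 2 + d) : IsSumThreeSquares n := by
  obtain ⟨a, ha⟩ := h
  have hapos : 0 < a := by
    refine pos_of_mul_pos_right ?_ hq.le
    rw [← ha]; positivity
  have := isSumThreeSquares_ternary_form a (d * n - 1) n 0 1 u hapos (by linarith)
    (by linear_combination (-n) * ha) 0 0 1
  simpa using this

open scoped NumberTheorySymbols in
theorem exists_dvd_sq_add_of_jacobiSym_eq_one {p d : ℕ} (hp : p.Prime) (hp2 : Odd p)
    (hd : Odd d) (hpd : p % 4 = 1 ∨ d % 4 = 3) (h : J(p | d) = 1) :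
    ∃ u : ℤ, (p : ℤ) ∣ u ^ 2 + d := by
  have : Fact p.Prime := ⟨hp⟩
  have hJ : J(-(d : ℤ) | p) = 1 := by
    rw [jacobiSym.neg _ hp2]
    rcases Nat.odd_mod_four_iff.mp (Nat.odd_iff.mp hp2) with h1 | h3
    · rw [ZMod.χ₄_nat_one_mod_four h1, one_mul,
        jacobiSym.quadratic_reciprocity_one_mod_four' hd h1, h]
    · rw [ZMod.χ₄_nat_three_mod_four h3,
        jacobiSym.quadratic_reciprocity_three_mod_four (by omega) h3, h]
      norm_num
  obtain ⟨v, hv⟩ := ZMod.isSquare_of_jacobiSym_eq_one hJ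
  obtain ⟨u, rfl⟩ := ZMod.intCast_surjective v
  refine ⟨u, (ZMod.intCast_zmod_eq_zero_iff_dvd _ p).mp ?_⟩
  push_cast at hv ⊢
  linear_combination -hv

open scoped NumberTheorySymbols in
theorem isSumThreeSquares_of_mod_four_eq_two {n : ℕ} (hn : n % 4 = 2) :
    IsSumThreeSquares n := by
  obtain ⟨p, hpgt, hp, hmod⟩ := Nat.forall_exists_prime_gt_and_modEq (4 * n) (q := 4 * n)
    (a := n - 1) (by omega) (by
      refine Nat.Coprime.mul_right ?_ ?_
      · exact Nat.Coprime.pow_right (m := 2) 2 (Nat.coprime_two_right.mpr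
          (Nat.odd_iff.mpr (by omega)))
      · exact (Nat.coprime_self_sub_left (by omega)).mpr (by simp))
  obtain ⟨j, hj⟩ := (Nat.modEq_iff_dvd' (by omega)).mp hmod.symm
  have hp' : p + 1 = (4 * j + 1) * n := by
    have : p = 4 * n * j + (n - 1) := by omega
    rw [this, add_assoc, Nat.sub_add_cancel (by omega)]; ring
  have hp4 : p % 4 = 1 := by
    have := congrArg (· % 4) hp'
    simp [Nat.mul_mod, Nat.add_mod, hn] at this
    omega
  have hd : Odd (4 * j + 1) := ⟨2 * j, by ring⟩
  have hJ : J(p | 4 * j + 1) = 1 := by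
    have h : J(p | 4 * j + 1) = J(-1 | 4 * j + 1) := by
      refine jacobiSym.mod_left' (Int.ModEq.symm ((Int.modEq_iff_dvd).mpr ⟨n, ?_⟩))
      have := congrArg (Nat.cast : ℕ → ℤ) hp'
      push_cast at this ⊢
      linarith
    rw [h, jacobiSym.at_neg_one hd, ZMod.χ₄_nat_one_mod_four (by omega)]
  obtain ⟨u, hu⟩ := exists_dvd_sq_add_of_jacobiSym_eq_one hp (Nat.odd_iff.mpr (by omega)) hd
    (Or.inl hp4) hJ
  have hpz : ((4 * j + 1 : ℕ) : ℤ) * n - 1 = p := by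
    have := congrArg (Nat.cast : ℕ → ℤ) hp'
    push_cast at this ⊢
    linarith
  refine isSumThreeSquares_of_dvd_sq_add (d := (4 * j + 1 : ℕ)) (u := u) (by positivity) ?_ ?_
  · rw [hpz]; exact_mod_cast hp.pos
  · rwa [hpz]

open scoped NumberTheorySymbols in
theorem isSumThreeSquares_of_odd {n : ℕ} (hn : n % 8 = 1 ∨ n % 8 = 3 ∨ n % 8 = 5) :
    IsSumThreeSquares n := by
  obtain ⟨c, m, hc, hm, hcm⟩ : ∃ c m : ℕ, (c = 1 ∨ c = 3) ∧ c * n = 2 * m + 1 ∧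
      (c = 1 ∧ m % 4 = 1 ∨ c = 3 ∧ m % 2 = 1) := by
    rcases hn with h | h | h
    · exact ⟨3, (3 * n - 1) / 2, by omega, by omega, by omega⟩
    · exact ⟨1, (n - 1) / 2, by omega, by omega, by omega⟩
    · exact ⟨3, (3 * n - 1) / 2, by omega, by omega, by omega⟩
  obtain ⟨p, hpgt, hp, hmod⟩ := Nat.forall_exists_prime_gt_and_modEq m (q := 4 * n)
    (a := m) (by omega) (by
      refine Nat.Coprime.mul_right ?_ ?_
      · exact Nat.Coprime.pow_right (m := 2) 2 (Nat.coprime_two_right.mpr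
          (Nat.odd_iff.mpr (by omega)))
      · refine Nat.Coprime.symm (Nat.Coprime.of_dvd_left (Nat.dvd_mul_left n c) ?_)
        rw [hm]; simp)
  obtain ⟨j, hj⟩ := (Nat.modEq_iff_dvd' (by omega)).mp hmod.symm
  have hpj : p = 4 * (n * j) + m := by
    rw [mul_assoc] at hj; omega
  have hp' : 2 * p + 1 = (8 * j + c) * n := by
    rw [hpj]; linarith
  have hpodd : Odd p := Nat.odd_iff.mpr (by omega)
  have hd : Odd (8 * j + c) := Nat.odd_iff.mpr (by omega)
  have hJ : J(p | 8 * j + c) = 1 := by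
    have h : J(2 | 8 * j + c) * J(p | 8 * j + c) = J(-1 | 8 * j + c) := by
      rw [← jacobiSym.mul_left]
      refine jacobiSym.mod_left' (Int.ModEq.symm ((Int.modEq_iff_dvd).mpr ⟨n, ?_⟩))
      have := congrArg (Nat.cast : ℕ → ℤ) hp'
      push_cast at this ⊢
      linarith
    rw [jacobiSym.at_neg_one hd, jacobiSym.at_two hd, ZMod.χ₈_nat_eq_if_mod_eight] at h
    rcases hc with rfl | rfl
    · rw [ZMod.χ₄_nat_one_mod_four (by omega), if_neg (by omega), if_pos (by omega)] at h
      linarith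
    · rw [ZMod.χ₄_nat_three_mod_four (by omega), if_neg (by omega), if_neg (by omega)] at h
      linarith
  obtain ⟨u, hu⟩ : ∃ u : ℤ, (p : ℤ) ∣ u ^ 2 + (8 * j + c : ℕ) :=
    exists_dvd_sq_add_of_jacobiSym_eq_one hp hpodd hd (by omega) hJ
  have hpz : ((8 * j + c : ℕ) : ℤ) * n - 1 = 2 * p := by
    have := congrArg (Nat.cast : ℕ → ℤ) hp'
    push_cast at this ⊢
    linarith
  obtain ⟨v, hv, hv2⟩ : ∃ v : ℤ, (p : ℤ) ∣ v ^ 2 + (8 * j + c : ℕ) ∧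
      (2 : ℤ) ∣ v ^ 2 + (8 * j + c : ℕ) := by
    have hdz : Odd ((8 * j + c : ℕ) : ℤ) := by exact_mod_cast hd
    have hpz' : Odd (p : ℤ) := by exact_mod_cast hpodd
    rcases Int.even_or_odd u with h | h
    · refine ⟨u + p, ?_, ((h.add_odd hpz').pow.add_odd hdz).two_dvd⟩
      rw [show (u + p) ^ 2 + ((8 * j + c : ℕ) : ℤ) =
        u ^ 2 + (8 * j + c : ℕ) + p * (2 * u + p) by ring]
      exact dvd_add hu (dvd_mul_right _ _)
    · exact ⟨u, hu, (h.pow.add_odd hdz).two_dvd⟩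
  have hcop : IsCoprime (2 : ℤ) p := by
    exact_mod_cast Nat.isCoprime_iff_coprime.mpr (Nat.coprime_two_left.mpr hpodd)
  refine isSumThreeSquares_of_dvd_sq_add (d := (8 * j + c : ℕ)) (u := v) ?_ ?_ ?_
  · have := hd.pos; exact_mod_cast this
  · rw [hpz]; have := hp.pos; positivity
  · rw [hpz]; exact hcop.mul_dvd hv2 hv

/-- **Legendre's three-square theorem** for integers not divisible by four. -/
theorem isSumThreeSquares_of_mod_eight {n : ℕ} (h4 : n % 4 ≠ 0) (h8 : n % 8 ≠ 7) :
    IsSumThreeSquares n := by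
  by_cases h : n % 4 = 2
  · exact isSumThreeSquares_of_mod_four_eq_two h
  · exact isSumThreeSquares_of_odd (by omega)

theorem exists_sign_modEq_three {a b : ℤ} (ha : a % 3 ≠ 0) (hb : b % 3 ≠ 0) :
    ∃ b' : ℤ, b' ^ 2 = b ^ 2 ∧ b' % 3 = a % 3 := by
  by_cases h : b % 3 = a % 3
  · exact ⟨b, rfl, h⟩
  · exact ⟨-b, by ring, by omega⟩

theorem sq_emod_three (a : ℤ) : a ^ 2 % 3 = if a % 3 = 0 then 0 else 1 := by
  have : a % 3 = 0 ∨ a % 3 = 1 ∨ a % 3 = 2 := by omega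
  rcases this with h | h | h <;> simp [pow_two, Int.mul_emod, h]

theorem exists_modEq_three_of_isSumThreeSquares {n : ℤ} (h : IsSumThreeSquares (3 * n)) :
    ∃ a b c : ℤ, 3 * n = a ^ 2 + b ^ 2 + c ^ 2 ∧ a % 3 = b % 3 ∧ b % 3 = c % 3 := by
  obtain ⟨a, b, c, h⟩ := h
  have ha := sq_emod_three a
  have hb := sq_emod_three b
  have hc := sq_emod_three c
  by_cases h0 : a % 3 = 0
  · refine ⟨a, b, c, h, ?_⟩
    split_ifs at ha hb hc <;> omega
  · have hb0 : b % 3 ≠ 0 := by intro; split_ifs at ha hb hc <;> omega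
    have hc0 : c % 3 ≠ 0 := by intro; split_ifs at ha hb hc; omega
    obtain ⟨b', hb2, hb'⟩ := exists_sign_modEq_three h0 hb0
    obtain ⟨c', hc2, hc'⟩ := exists_sign_modEq_three h0 hc0
    exact ⟨a, b', c', by rw [hb2, hc2, h], hb'.symm, hb'.trans hc'.symm⟩

/-- Two of any three squares agree modulo three, so every sum of three squares is a sum of
four squares of integers `x, y, z, w` with `x + 2 * y + 2 * z = 0`. -/
theorem exists_sum_four_squares_orthogonal {n : ℤ} (h : IsSumThreeSquares n) :
    ∃ x y z w : ℤ, n = x ^ 2 + y ^ 2 + z ^ 2 + w ^ 2 ∧ x + 2 * y + 2 * z = 0 := by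
  obtain ⟨p, q, w, rfl, hpq⟩ : ∃ p q w : ℤ, n = p ^ 2 + q ^ 2 + w ^ 2 ∧ (3 : ℤ) ∣ p + q := by
    obtain ⟨a, b, c, rfl⟩ := h
    have : (3 : ℤ) ∣ a + b ∨ (3 : ℤ) ∣ a + -b ∨ (3 : ℤ) ∣ a + c ∨ (3 : ℤ) ∣ a + -c ∨
        (3 : ℤ) ∣ b + c ∨ (3 : ℤ) ∣ b + -c := by
      have key (a : ℤ) : a % 3 = 0 ∨ a % 3 = 1 ∨ a % 3 = 2 := by omega
      rcases key a with ha | ha | ha <;> rcases key b with hb | hb | hb <;>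
        rcases key c with hc | hc | hc <;> omega
    rcases this with h | h | h | h | h | h
    exacts [⟨_, _, c, by ring, h⟩, ⟨_, _, c, by ring, h⟩, ⟨_, _, b, by ring, h⟩,
      ⟨_, _, b, by ring, h⟩, ⟨_, _, a, by ring, h⟩, ⟨_, _, a, by ring, h⟩]
  obtain ⟨s, hs⟩ := hpq
  obtain rfl : q = 3 * s - p := by linarith
  exact ⟨-2 * s, 2 * s - p, p - s, w, by ring, by ring⟩

theorem exists_two_mul_sq_add {n : ℤ} (h : IsSumThreeSquares (2 * n)) :
    ∃ y z w : ℤ, n = 2 * y ^ 2 + z ^ 2 + w ^ 2 := by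
  obtain ⟨a, b, c, hab, h⟩ : ∃ a b c : ℤ, (2 : ℤ) ∣ a - b ∧ 2 * n = a ^ 2 + b ^ 2 + c ^ 2 := by
    obtain ⟨a, b, c, h⟩ := h
    have : (2 : ℤ) ∣ a - b ∨ (2 : ℤ) ∣ a - c ∨ (2 : ℤ) ∣ b - c := by omega
    rcases this with h' | h' | h'
    exacts [⟨_, _, c, h', h⟩, ⟨_, _, b, h', by linarith⟩, ⟨_, _, a, h', by linarith⟩]
  obtain ⟨z, hz⟩ := hab
  obtain rfl : a = b + 2 * z := by linarith
  have hc : Even c := by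
    have : Even (c ^ 2) := ⟨n - b ^ 2 - 2 * b * z - 2 * z ^ 2, by linarith⟩
    exact (Int.even_pow.mp this).1
  obtain ⟨y, rfl⟩ := hc
  exact ⟨y, b + z, z, by linarith⟩

theorem exists_five_mul_sq_add {n : ℤ} (h : IsSumThreeSquares (5 * n)) :
    ∃ y z w : ℤ, n = 5 * y ^ 2 + z ^ 2 + w ^ 2 := by
  have key (a : ℤ) : a % 5 = 0 ∧ a ^ 2 % 5 = 0 ∨ (a % 5 = 1 ∨ a % 5 = 4) ∧ a ^ 2 % 5 = 1 ∨
      (a % 5 = 2 ∨ a % 5 = 3) ∧ a ^ 2 % 5 = 4 := by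
    have : a % 5 = 0 ∨ a % 5 = 1 ∨ a % 5 = 2 ∨ a % 5 = 3 ∨ a % 5 = 4 := by omega
    rcases this with h | h | h | h | h <;> simp [pow_two, Int.mul_emod, h]
  obtain ⟨a, b, c, ha, h⟩ : ∃ a b c : ℤ, (5 : ℤ) ∣ a ∧ 5 * n = a ^ 2 + b ^ 2 + c ^ 2 := by
    obtain ⟨a, b, c, h⟩ := h
    have ha := key a
    have hb := key b
    have hc := key c
    have : (5 : ℤ) ∣ a ∨ (5 : ℤ) ∣ b ∨ (5 : ℤ) ∣ c := by omega
    rcases this with h' | h' | h'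
    exacts [⟨_, b, c, h', h⟩, ⟨_, a, c, h', by linarith⟩, ⟨_, a, b, h', by linarith⟩]
  obtain ⟨y, rfl⟩ := ha
  obtain ⟨c, hc, h⟩ : ∃ c' : ℤ, (5 : ℤ) ∣ c' + 2 * b ∧ 5 * n = (5 * y) ^ 2 + b ^ 2 + c' ^ 2 := by
    have hb := key b
    have hc := key c
    have hy : (5 * y) ^ 2 = 5 * (5 * y ^ 2) := by ring
    have : (5 : ℤ) ∣ c + 2 * b ∨ (5 : ℤ) ∣ -c + 2 * b := by omega
    rcases this with h' | h'
    exacts [⟨_, h', h⟩, ⟨_, h', by rw [neg_sq]; exact h⟩]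
  obtain ⟨w, hw⟩ := hc
  obtain rfl : c = 5 * w - 2 * b := by linarith
  exact ⟨y, w, b - 2 * w, by linarith⟩

theorem exists_sq_add_sq_add_add_sq_add {n : ℤ} (h : IsSumThreeSquares (3 * n)) :
    ∃ x y w : ℤ, n = x ^ 2 + y ^ 2 + (x + y) ^ 2 + w ^ 2 := by
  obtain ⟨a, b, c, h, hab, hbc⟩ := exists_modEq_three_of_isSumThreeSquares h
  obtain ⟨x, hx⟩ : (3 : ℤ) ∣ a - b := by omega
  obtain ⟨y, hy⟩ : (3 : ℤ) ∣ b - c := by omega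
  obtain rfl : b = c + 3 * y := by linarith
  obtain rfl : a = c + 3 * y + 3 * x := by linarith
  exact ⟨x, y, c + 2 * y + x, by linarith⟩

theorem exists_three_mul_sq_add_two_mul_sq_add {n : ℤ} (hn : n % 8 = 7)
    (h : IsSumThreeSquares (6 * n)) :
    ∃ z t w : ℤ, n = 3 * z ^ 2 + 2 * t ^ 2 + w ^ 2 := by
  obtain ⟨a, b, c, h, hab, hbc, hab', hc⟩ : ∃ a b c : ℤ, 6 * n = a ^ 2 + b ^ 2 + c ^ 2 ∧
      a % 3 = b % 3 ∧ b % 3 = c % 3 ∧ a % 2 = b % 2 ∧ c % 2 = 0 := by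
    have key (a : ℤ) : a % 2 = 0 ∧ a ^ 2 % 4 = 0 ∨ a % 2 = 1 ∧ a ^ 2 % 4 = 1 := by
      have : a % 4 = 0 ∨ a % 4 = 1 ∨ a % 4 = 2 ∨ a % 4 = 3 := by omega
      rcases this with h | h | h | h <;> simp [pow_two, Int.mul_emod, h] <;> omega
    obtain ⟨a, b, c, h, hab, hbc⟩ :=
      exists_modEq_three_of_isSumThreeSquares (n := 2 * n) (by convert h using 1; ring)
    have ha2 := key a
    have hb2 := key b
    have hc2 := key c
    have : c % 2 = 0 ∧ a % 2 = b % 2 ∨ b % 2 = 0 ∧ a % 2 = c % 2 ∨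
        a % 2 = 0 ∧ b % 2 = c % 2 := by omega
    rcases this with h' | h' | h'
    exacts [⟨a, b, c, by linarith, by omega⟩, ⟨a, c, b, by linarith, by omega⟩,
      ⟨b, c, a, by linarith, by omega⟩]
  obtain ⟨z, hz⟩ : (6 : ℤ) ∣ a - b := by omega
  obtain ⟨t, ht⟩ : (6 : ℤ) ∣ a + b + c := by omega
  obtain rfl : a = b + 6 * z := by linarith
  obtain rfl : c = 6 * t - 2 * b - 6 * z := by linarith
  exact ⟨z, t, b + 3 * z - 2 * t, by linarith⟩

theorem stmt_2 (n : ℕ) :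
    (∃ x y z w : ℤ, (n : ℤ) = x ^ 2 + y ^ 2 + z ^ 2 + w ^ 2 ∧
        (x - y) * (x + 2 * y + 2 * z) = 0) ∧
    (∃ x y z w : ℤ, (n : ℤ) = x ^ 2 + y ^ 2 + z ^ 2 + w ^ 2 ∧
        (x - 2 * y) * (x + 2 * y + 2 * z) = 0) ∧
    (∃ x y z w : ℤ, (n : ℤ) = x ^ 2 + y ^ 2 + z ^ 2 + w ^ 2 ∧
        (x + y - z) * (x + 2 * y + 2 * z) = 0) ∧
    (∃ x y z w : ℤ, (n : ℤ) = x ^ 2 + y ^ 2 + z ^ 2 + w ^ 2 ∧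
        (x + y - 2 * z) * (x + 2 * y + 2 * z) = 0) := by
  induction n using Nat.strong_induction_on with
  | _ n ih =>
  by_cases h4 : n % 4 = 0
  · rcases Nat.eq_zero_or_pos n with rfl | hpos
    · exact ⟨⟨0, 0, 0, 0, by simp⟩, ⟨0, 0, 0, 0, by simp⟩, ⟨0, 0, 0, 0, by simp⟩,
        ⟨0, 0, 0, 0, by simp⟩⟩
    obtain ⟨m, rfl⟩ := Nat.dvd_of_mod_eq_zero h4
    obtain ⟨⟨x₁, y₁, z₁, w₁, h₁, e₁⟩, ⟨x₂, y₂, z₂, w₂, h₂, e₂⟩, ⟨x₃, y₃, z₃, w₃, h₃, e₃⟩,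
      ⟨x₄, y₄, z₄, w₄, h₄, e₄⟩⟩ := ih m (by omega)
    push_cast
    exact ⟨⟨2 * x₁, 2 * y₁, 2 * z₁, 2 * w₁, by rw [h₁]; ring, by linear_combination 4 * e₁⟩,
      ⟨2 * x₂, 2 * y₂, 2 * z₂, 2 * w₂, by rw [h₂]; ring, by linear_combination 4 * e₂⟩,
      ⟨2 * x₃, 2 * y₃, 2 * z₃, 2 * w₃, by rw [h₃]; ring, by linear_combination 4 * e₃⟩,
      ⟨2 * x₄, 2 * y₄, 2 * z₄, 2 * w₄, by rw [h₄]; ring, by linear_combination 4 * e₄⟩⟩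
  by_cases h8 : n % 8 = 7
  · have key (k : ℕ) (hk : k * n % 4 ≠ 0) (hk' : k * n % 8 ≠ 7) :
        IsSumThreeSquares ((k : ℤ) * n) := by
      exact_mod_cast isSumThreeSquares_of_mod_eight hk hk'
    refine ⟨?_, ?_, ?_, ?_⟩
    · obtain ⟨y, z, w, h⟩ := exists_two_mul_sq_add (key 2 (by omega) (by omega))
      exact ⟨y, y, z, w, by rw [h]; ring, by ring⟩
    · obtain ⟨y, z, w, h⟩ := exists_five_mul_sq_add (key 5 (by omega) (by omega))
      exact ⟨2 * y, y, z, w, by rw [h]; ring, by ring⟩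
    · obtain ⟨x, y, w, h⟩ := exists_sq_add_sq_add_add_sq_add (key 3 (by omega) (by omega))
      exact ⟨x, y, x + y, w, h, by ring⟩
    · obtain ⟨z, t, w, h⟩ := exists_three_mul_sq_add_two_mul_sq_add (by omega)
        (key 6 (by omega) (by omega))
      exact ⟨z + t, z - t, z, w, by rw [h]; ring, by ring⟩
  · obtain ⟨x, y, z, w, h, e⟩ :=
      exists_sum_four_squares_orthogonal (isSumThreeSquares_of_mod_eight h4 h8)
    exact ⟨⟨x, y, z, w, h, by rw [e, mul_zero]⟩, ⟨x, y, z, w, h, by rw [e, mul_zero]⟩,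
      ⟨x, y, z, w, h, by rw [e, mul_zero]⟩, ⟨x, y, z, w, h, by rw [e, mul_zero]⟩⟩
end

section
/- For each m ∈ {2,3}, every natural number n can be written as n = x^2 + y^2 + z^2 + w^2 with x, y, z, w integers such that x + y + z + w = t^m for some integer t (i.e., x + y + z + w is an m-th power of an integer). -/
open scoped NumberTheorySymbols

/-- Division with remainder of least absolute value. -/
lemma exists_abs_two_mul_sub_mul_le {a : ℤ} (ha : 0 < a) (d : ℤ) :
    ∃ k : ℤ, |2 * (d - k * a)| ≤ a := by
  refine ⟨(2 * d + a) / (2 * a), ?_⟩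
  have h₁ := Int.emod_add_mul_ediv (2 * d + a) (2 * a)
  have h₂ := Int.emod_nonneg (2 * d + a) (b := 2 * a) (by lia)
  have h₃ := Int.emod_lt_of_pos (2 * d + a) (b := 2 * a) (by lia)
  generalize (2 * d + a) / (2 * a) = k at *
  rw [abs_le]
  constructor <;> nlinarith

/-- A reduced positive definite ternary form of determinant one is a sum of three squares. -/
lemma ternary_form_eq_sum_three_squares_of_reduced {a b c d e f : ℤ} (ha : 0 < a)
    (hB : 0 < a * b - d ^ 2)
    (hdet : a * b * c + 2 * d * e * f - a * f ^ 2 - b * e ^ 2 - c * d ^ 2 = 1)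
    (hd : |2 * d| ≤ a) (hab : a ≤ b) (hf : |2 * (a * f - d * e)| ≤ a * b - d ^ 2)
    (hBC : a * b - d ^ 2 ≤ a * c - e ^ 2) (x y z : ℤ) :
    ∃ p q r : ℤ, a * x ^ 2 + b * y ^ 2 + c * z ^ 2 + 2 * d * x * y + 2 * e * x * z
      + 2 * f * y * z = p ^ 2 + q ^ 2 + r ^ 2 := by
  have hBCE : (a * b - d ^ 2) * (a * c - e ^ 2) - (a * f - d * e) ^ 2 = a := by
    linear_combination a * hdet
  have hd2 : 4 * d ^ 2 ≤ a ^ 2 := by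
    have := sq_le_sq' (abs_le.1 hd).1 (abs_le.1 hd).2
    nlinarith
  have hE2 : 4 * (a * f - d * e) ^ 2 ≤ (a * b - d ^ 2) ^ 2 := by
    have := sq_le_sq' (abs_le.1 hf).1 (abs_le.1 hf).2
    nlinarith
  have h₁ : 3 * a ^ 2 ≤ 4 * (a * b - d ^ 2) := by nlinarith
  have h₂ : 3 * (a * b - d ^ 2) ^ 2 ≤ 4 * a := by nlinarith
  have ha1 : a = 1 := by
    by_contra hne
    have : 2 ≤ a := by lia
    have h₃ : 3 * a ≤ 2 * (a * b - d ^ 2) := by nlinarith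
    nlinarith
  subst ha1
  have hd0 : d = 0 := by
    rw [abs_le] at hd
    lia
  subst hd0
  have hb1 : b = 1 := by nlinarith
  subst hb1
  have hf0 : f = 0 := by
    rw [abs_le] at hf
    lia
  subst hf0
  exact ⟨x + e * z, y, z, by linear_combination z ^ 2 * hdet⟩

/-- Every value of a positive definite ternary form of determinant one is a sum of three
squares. -/
theorem ternary_form_eq_sum_three_squares (a b c d e f : ℤ) (ha : 0 < a)
    (hB : 0 < a * b - d ^ 2)
    (hdet : a * b * c + 2 * d * e * f - a * f ^ 2 - b * e ^ 2 - c * d ^ 2 = 1) (x y z : ℤ) :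
    ∃ p q r : ℤ, a * x ^ 2 + b * y ^ 2 + c * z ^ 2 + 2 * d * x * y + 2 * e * x * z
      + 2 * f * y * z = p ^ 2 + q ^ 2 + r ^ 2 := by
  obtain ⟨M, hM⟩ : ∃ M : ℕ, M = a.toNat := ⟨_, rfl⟩
  obtain ⟨N, hN⟩ : ∃ N : ℕ, N = (a * b - d ^ 2).toNat := ⟨_, rfl⟩
  induction M using Nat.strong_induction_on generalizing a b c d e f x y z N with
  | _ M ihM =>
  induction N using Nat.strong_induction_on generalizing a b c d e f x y z with
  | _ N ihN =>
  obtain ⟨k, hk⟩ := exists_abs_two_mul_sub_mul_le hB (a * f - d * e)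
  obtain ⟨l, hl⟩ := exists_abs_two_mul_sub_mul_le ha d
  -- the sheared form, with variables `x + l * y`, `y + k * z`, `z`
  obtain ⟨b', hb'⟩ : ∃ b', b' = b - 2 * l * d + l ^ 2 * a := ⟨_, rfl⟩
  obtain ⟨c', hc'⟩ : ∃ c', c' = c - 2 * k * f + k ^ 2 * b := ⟨_, rfl⟩
  obtain ⟨d', hd'⟩ : ∃ d', d' = d - l * a := ⟨_, rfl⟩
  obtain ⟨e', he'⟩ : ∃ e', e' = e - k * d := ⟨_, rfl⟩
  obtain ⟨f', hf'⟩ : ∃ f', f' = f - k * b - l * e' := ⟨_, rfl⟩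
  have hBeq : a * b' - d' ^ 2 = a * b - d ^ 2 := by subst hb' hd'; ring
  have hEeq : a * f' - d' * e' = a * f - d * e - k * (a * b - d ^ 2) := by
    subst hf' hd' he'; ring
  have hdet' : a * b' * c' + 2 * d' * e' * f' - a * f' ^ 2 - b' * e' ^ 2 - c' * d' ^ 2 = 1 := by
    rw [← hdet]; subst hf' hd' he' hb' hc'; ring
  have key : a * x ^ 2 + b * y ^ 2 + c * z ^ 2 + 2 * d * x * y + 2 * e * x * z + 2 * f * y * z
      = a * (x + l * (y + k * z)) ^ 2 + b' * (y + k * z) ^ 2 + c' * z ^ 2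
        + 2 * d' * (x + l * (y + k * z)) * (y + k * z) + 2 * e' * (x + l * (y + k * z)) * z
        + 2 * f' * (y + k * z) * z := by
    subst hf' hd' he' hb' hc'; ring
  rw [key]
  rw [← hd'] at hl
  rw [← hEeq, ← hBeq] at hk
  rw [← hBeq] at hB hN
  clear key hEeq hBeq hb' hc' hd' he' hf' hdet
  generalize x + l * (y + k * z) = X
  generalize y + k * z = Y
  have hb'pos : 0 < b' := by
    by_contra! h
    nlinarith [sq_nonneg d']
  by_cases hab : b' < a
  · obtain ⟨p, q, r, h⟩ := ihM b'.toNat (by lia) b' a c' d' f' e' hb'pos (by linarith)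
      (by linarith) Y X z rfl _ rfl
    exact ⟨p, q, r, by linarith⟩
  by_cases hBC : a * c' - e' ^ 2 < a * b' - d' ^ 2
  · have hC : 0 < a * c' - e' ^ 2 := by
      have h : (a * b' - d' ^ 2) * (a * c' - e' ^ 2) = a + (a * f' - d' * e') ^ 2 := by
        linear_combination a * hdet'
      refine pos_of_mul_pos_right (?_ : 0 < (a * b' - d' ^ 2) * (a * c' - e' ^ 2)) hB.le
      rw [h]; positivity
    obtain ⟨p, q, r, h⟩ := ihN (a * c' - e' ^ 2).toNat (by lia) a c' b' e' d' f' ha hC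
      (by linarith) X z Y hM rfl
    exact ⟨p, q, r, by linarith⟩
  exact ternary_form_eq_sum_three_squares_of_reduced ha hB hdet' hl (by lia) hk (by lia) X Y z

/-- If `-d` is a square modulo `d * n - 1`, then `n` is a sum of three squares. -/
lemma sum_three_squares_of_dvd {n d k : ℤ} (hd : 0 < d) (hdn : 0 < d * n - 1)
    (h : d * n - 1 ∣ d + k ^ 2) : ∃ p q r : ℤ, n = p ^ 2 + q ^ 2 + r ^ 2 := by
  obtain ⟨a, ha⟩ := h
  have hapos : 0 < a := by
    refine pos_of_mul_pos_right (?_ : 0 < (d * n - 1) * a) hdn.le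
    rw [← ha]; positivity
  obtain ⟨p, q, r, h⟩ := ternary_form_eq_sum_three_squares a (d * n - 1) n k 1 0 hapos
    (by linarith) (by linear_combination -n * ha) 0 0 1
  exact ⟨p, q, r, by linarith⟩

lemma exists_dvd_add_sq_of_jacobiSym_eq_one {p : ℕ} (hp : p.Prime) {d : ℤ}
    (h : J(-d | p) = 1) : ∃ k : ℤ, (p : ℤ) ∣ d + k ^ 2 := by
  have : Fact p.Prime := ⟨hp⟩
  obtain ⟨r, hr⟩ := ZMod.isSquare_of_jacobiSym_eq_one h
  refine ⟨r.valMinAbs, ?_⟩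
  rw [← ZMod.intCast_zmod_eq_zero_iff_dvd]
  push_cast [ZMod.coe_valMinAbs] at hr ⊢
  linear_combination -hr

/-- Reciprocity for `J(-d | p)` when `-d` or `p` is one modulo four. -/
lemma jacobiSym_neg_eq {d p : ℕ} (hd : d % 2 = 1) (hp : p % 2 = 1)
    (h : d % 4 = 1 ∧ p % 4 = 1 ∨ d % 4 = 3) : J(-d | p) = J(p | d) := by
  have hd' := Nat.odd_iff.2 hd
  have hp' := Nat.odd_iff.2 hp
  rw [jacobiSym.neg _ hp']
  rcases Nat.odd_mod_four_iff.1 hp with hp4 | hp4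
  · rw [ZMod.χ₄_nat_one_mod_four hp4, one_mul,
      jacobiSym.quadratic_reciprocity_one_mod_four' hd' hp4]
  · have hd4 : d % 4 = 3 := by lia
    rw [ZMod.χ₄_nat_three_mod_four hp4, jacobiSym.quadratic_reciprocity_three_mod_four hd4 hp4]
    ring

lemma sum_three_squares_of_mod_four_eq_two {n : ℕ} (hn : n % 4 = 2) :
    ∃ p q r : ℤ, (n : ℤ) = p ^ 2 + q ^ 2 + r ^ 2 := by
  have hcop : IsCoprime (n - 1 : ℤ) ((4 * n : ℕ) : ℤ) := by
    push_cast
    refine IsCoprime.mul_right ?_ ⟨-1, 1, by ring⟩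
    obtain ⟨m, rfl⟩ : ∃ m, n = 4 * m + 2 := ⟨n / 4, by lia⟩
    exact ⟨1, -m, by push_cast; ring⟩
  obtain ⟨p, hpn, hp, hmod⟩ :=
    Nat.forall_exists_prime_gt_and_zmodEq (4 * n) (by lia) hcop
  obtain ⟨v, hv⟩ := hmod.symm.dvd
  push_cast at hv
  have hv0 : 0 ≤ v := by
    by_contra! h
    nlinarith
  lift v to ℕ using hv0
  have hpd : ((4 * v + 1 : ℕ) : ℤ) * n - 1 = p := by push_cast; linarith
  have hp4 : p % 4 = 1 := by
    have h : (p : ℤ) = 4 * (n * v) + n - 1 := by linarith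
    generalize (n : ℤ) * v = w at h
    lia
  have hJ : J(-((4 * v + 1 : ℕ) : ℤ) | p) = 1 := by
    rw [jacobiSym_neg_eq (by lia) (by lia) (by lia), ← hpd,
      jacobiSym.mod_left' (a₂ := -1) (by rw [sub_eq_add_neg, Int.mul_add_emod_self_left]),
      jacobiSym.at_neg_one (Nat.odd_iff.2 (by lia)), ZMod.χ₄_nat_one_mod_four (by lia)]
  obtain ⟨k, hk⟩ := exists_dvd_add_sq_of_jacobiSym_eq_one hp hJ
  exact sum_three_squares_of_dvd (by positivity) (hpd ▸ mod_cast hp.pos) (hpd ▸ hk)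

lemma sum_three_squares_of_odd {n : ℕ} (hn : n % 8 = 1 ∨ n % 8 = 3 ∨ n % 8 = 5) :
    ∃ p q r : ℤ, (n : ℤ) = p ^ 2 + q ^ 2 + r ^ 2 := by
  -- `2 * a + 1 = c * n`
  obtain ⟨c, a, hca, hc, ha⟩ : ∃ c a : ℕ, 2 * a + 1 = c * n ∧ (c = 1 ∨ c = 3) ∧
      a % 2 = 1 ∧ (c % 4 = 1 ∧ a % 4 = 1 ∨ c % 4 = 3) := by
    rcases hn with hn | hn | hn
    · exact ⟨3, (3 * n - 1) / 2, by lia, by lia, by lia, by lia⟩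
    · exact ⟨1, (n - 1) / 2, by lia, by lia, by lia, by lia⟩
    · exact ⟨3, (3 * n - 1) / 2, by lia, by lia, by lia, by lia⟩
  have hcaz : 2 * (a : ℤ) + 1 = c * n := by exact_mod_cast hca
  have hcop : IsCoprime (a : ℤ) ((4 * n : ℕ) : ℤ) := by
    push_cast
    refine IsCoprime.mul_right ?_ ⟨-2, c, by linarith⟩
    have h2 : IsCoprime (a : ℤ) 2 := by
      obtain ⟨m, rfl⟩ : ∃ m, a = 2 * m + 1 := ⟨a / 2, by lia⟩
      exact ⟨1, -m, by push_cast; ring⟩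
    simpa using h2.mul_right h2
  obtain ⟨p, hpn, hp, hmod⟩ :=
    Nat.forall_exists_prime_gt_and_zmodEq (4 * n) (by lia) hcop
  obtain ⟨v, hv⟩ := hmod.symm.dvd
  push_cast at hv
  have hv0 : 0 ≤ v := by
    by_contra! h
    rcases hc with rfl | rfl <;> nlinarith
  lift v to ℕ using hv0
  have hpd : ((8 * v + c : ℕ) : ℤ) * n - 1 = 2 * p := by push_cast; linarith
  have hpa : p % 4 = a % 4 := by
    have h : (p : ℤ) = 4 * (n * v) + a := by linarith
    generalize (n : ℤ) * v = w at h
    lia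
  have hJ : J(-((8 * v + c : ℕ) : ℤ) | p) = 1 := by
    have h8 : J(-2 | 8 * v + c) = 1 := by
      rw [jacobiSym.at_neg_two (Nat.odd_iff.2 (by lia)), ZMod.χ₈'_nat_eq_if_mod_eight]
      rw [if_neg (by lia), if_pos (by lia)]
    have hone : J(-2 * p | 8 * v + c) = 1 := by
      have h : -2 * (p : ℤ) = 1 + ((8 * v + c : ℕ) : ℤ) * (-n) := by linarith
      rw [h, jacobiSym.mod_left' (a₂ := 1) (Int.add_mul_emod_self_left _ _ _),
        jacobiSym.one_left]
    rw [jacobiSym_neg_eq (by lia) (by lia) (by lia), ← hone, jacobiSym.mul_left, h8, one_mul]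
  obtain ⟨k, hk⟩ := exists_dvd_add_sq_of_jacobiSym_eq_one hp hJ
  obtain ⟨l, hl, hl2⟩ : ∃ l : ℤ, (p : ℤ) ∣ ((8 * v + c : ℕ) : ℤ) + l ^ 2 ∧ Odd l := by
    rcases Int.even_or_odd k with hk2 | hk2
    · refine ⟨k + p, ?_, hk2.add_odd (by exact_mod_cast Nat.odd_iff.2 (by lia))⟩
      have : ((8 * v + c : ℕ) : ℤ) + (k + p) ^ 2
          = ((8 * v + c : ℕ) : ℤ) + k ^ 2 + p * (2 * k + p) := by ring
      rw [this]
      exact dvd_add hk (dvd_mul_right _ _)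
    · exact ⟨k, hk, hk2⟩
  have h2 : (2 : ℤ) ∣ ((8 * v + c : ℕ) : ℤ) + l ^ 2 := by
    refine even_iff_two_dvd.1 (Odd.add_odd ?_ hl2.pow)
    exact_mod_cast Nat.odd_iff.2 (by lia)
  have hcop2 : IsCoprime (2 : ℤ) p := by
    exact_mod_cast Nat.isCoprime_iff_coprime.2 ((Nat.coprime_two_left).2 (Nat.odd_iff.2 (by lia)))
  refine sum_three_squares_of_dvd (d := ((8 * v + c : ℕ) : ℤ)) (k := l) (by lia) ?_ ?_
  · rw [hpd]
    have := hp.pos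
    lia
  · rw [hpd]
    exact hcop2.mul_dvd h2 hl

/-- A sum of three squares `4 * n - 1` yields four squares with sum `n` and roots of sum one. -/
lemma exists_four_squares_sum_eq_one_of_odd {n : ℕ} (hn : n % 2 = 1) :
    ∃ x y z w : ℤ, (n : ℤ) = x ^ 2 + y ^ 2 + z ^ 2 + w ^ 2 ∧ x + y + z + w = 1 := by
  obtain ⟨a, b, c, h⟩ := sum_three_squares_of_odd (n := 4 * n - 1) (by lia)
  have h4 : 4 * (n : ℤ) = 1 + a ^ 2 + b ^ 2 + c ^ 2 := by
    have : ((4 * n - 1 : ℕ) : ℤ) = 4 * n - 1 := by lia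
    linarith
  have hodd : a % 2 = 1 ∧ b % 2 = 1 ∧ c % 2 = 1 := by
    have hsq (t : ℤ) : t % 2 = 0 ∧ t ^ 2 % 4 = 0 ∨ t % 2 = 1 ∧ t ^ 2 % 4 = 1 := by
      rcases Int.even_or_odd' t with ⟨s, rfl | rfl⟩
      · left; ring_nf; lia
      · right; ring_nf; lia
    have := hsq a
    have := hsq b
    have := hsq c
    lia
  obtain ⟨a', ha', hs⟩ : ∃ a' : ℤ, a' ^ 2 = a ^ 2 ∧ (1 + a' + b + c) % 4 = 0 := by
    by_cases h : (1 + a + b + c) % 4 = 0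
    · exact ⟨a, rfl, h⟩
    · exact ⟨-a, by ring, by lia⟩
  obtain ⟨x, hx⟩ : ∃ x, 1 + a' + b + c = 4 * x := ⟨(1 + a' + b + c) / 4, by lia⟩
  have ha2 : a' % 2 = 1 := by lia
  obtain ⟨u, hu⟩ : ∃ u, b + c = 2 * u := ⟨(b + c) / 2, by lia⟩
  obtain ⟨v, hv⟩ : ∃ v, a' + c = 2 * v := ⟨(a' + c) / 2, by lia⟩
  obtain ⟨w, hw⟩ : ∃ w, a' + b = 2 * w := ⟨(a' + b) / 2, by lia⟩
  refine ⟨x, x - u, x - v, x - w, ?_, by lia⟩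
  obtain rfl : a' = v + w - u := by lia
  obtain rfl : b = w + u - v := by lia
  obtain rfl : c = u + v - w := by lia
  obtain rfl : u = 4 * x - 1 - v - w := by lia
  rw [← ha'] at h4
  linarith

lemma exists_four_squares_sum_eq_two_mul {n : ℕ} (hn : n % 2 = 0) {s a b c : ℤ}
    (h : (n : ℤ) = s ^ 2 + a ^ 2 + b ^ 2 + c ^ 2) :
    ∃ x y z w : ℤ, (n : ℤ) = x ^ 2 + y ^ 2 + z ^ 2 + w ^ 2 ∧ x + y + z + w = 2 * s := by
  have hpar : (s + a + b + c) % 2 = 0 := by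
    have hsq (t : ℤ) : t ^ 2 % 2 = t % 2 := by
      rcases Int.even_or_odd' t with ⟨r, rfl | rfl⟩
      · ring_nf; lia
      · ring_nf; lia
    have := hsq s
    have := hsq a
    have := hsq b
    have := hsq c
    lia
  obtain ⟨x, hx⟩ : ∃ x, s + a + b + c = 2 * x := ⟨(s + a + b + c) / 2, by lia⟩
  refine ⟨x, x - b - c, x - a - c, x - a - b, ?_, by lia⟩
  obtain rfl : s = 2 * x - a - b - c := by lia
  linarith

lemma exists_four_squares_sum_eq_zero {n k u : ℕ} (hk : n = k ^ 2 * u) (hn : n % 2 = 0)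
    (hu : u % 4 = 2 ∨ u % 8 = 1 ∨ u % 8 = 3 ∨ u % 8 = 5) :
    ∃ x y z w : ℤ, (n : ℤ) = x ^ 2 + y ^ 2 + z ^ 2 + w ^ 2 ∧ x + y + z + w = 0 := by
  obtain ⟨a, b, c, h⟩ := hu.elim sum_three_squares_of_mod_four_eq_two sum_three_squares_of_odd
  refine exists_four_squares_sum_eq_two_mul hn (s := 0) (a := k * a) (b := k * b) (c := k * c) ?_
  rw [hk]
  push_cast
  rw [h]
  ring

theorem exists_four_squares_sum_eq_sq (n : ℕ) :
    ∃ x y z w : ℤ, (n : ℤ) = x ^ 2 + y ^ 2 + z ^ 2 + w ^ 2 ∧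
      ∃ t : ℤ, x + y + z + w = t ^ 2 := by
  induction n using Nat.strong_induction_on with
  | _ n ih =>
  rcases Nat.eq_zero_or_pos n with rfl | hpos
  · exact ⟨0, 0, 0, 0, by norm_num, 0, by norm_num⟩
  rcases Nat.mod_two_eq_zero_or_one n with hn | hn
  swap
  · obtain ⟨x, y, z, w, h, hs⟩ := exists_four_squares_sum_eq_one_of_odd hn
    exact ⟨x, y, z, w, h, 1, by rw [hs]; norm_num⟩
  by_cases h16 : n % 16 = 0
  · obtain ⟨x, y, z, w, h, t, hs⟩ := ih (n / 16) (by lia)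
    have hn' : (n : ℤ) = 16 * (n / 16 : ℕ) := by lia
    exact ⟨4 * x, 4 * y, 4 * z, 4 * w, by rw [hn', h]; ring, 2 * t, by linear_combination 4 * hs⟩
  by_cases h28 : n % 32 = 28
  · obtain ⟨a, b, c, h⟩ := sum_three_squares_of_mod_four_eq_two (n := n / 4 - 1) (by lia)
    have hn' : (n : ℤ) = 4 * (n / 4 - 1 : ℕ) + 4 := by lia
    obtain ⟨x, y, z, w, h, hs⟩ := exists_four_squares_sum_eq_two_mul hn
      (s := 2) (a := 2 * a) (b := 2 * b) (c := 2 * c) (by rw [hn', h]; ring)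
    exact ⟨x, y, z, w, h, 2, by rw [hs]; norm_num⟩
  have hzero : ∃ x y z w : ℤ, (n : ℤ) = x ^ 2 + y ^ 2 + z ^ 2 + w ^ 2 ∧ x + y + z + w = 0 := by
    by_cases h4 : n % 4 = 0
    · exact exists_four_squares_sum_eq_zero (k := 2) (u := n / 4) (by lia) hn (by lia)
    · exact exists_four_squares_sum_eq_zero (k := 1) (u := n) (by lia) hn (by lia)
  obtain ⟨x, y, z, w, h, hs⟩ := hzero
  exact ⟨x, y, z, w, h, 0, by rw [hs]; norm_num⟩

theorem exists_four_squares_sum_eq_cube (n : ℕ) :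
    ∃ x y z w : ℤ, (n : ℤ) = x ^ 2 + y ^ 2 + z ^ 2 + w ^ 2 ∧
      ∃ t : ℤ, x + y + z + w = t ^ 3 := by
  induction n using Nat.strong_induction_on with
  | _ n ih =>
  rcases Nat.eq_zero_or_pos n with rfl | hpos
  · exact ⟨0, 0, 0, 0, by norm_num, 0, by norm_num⟩
  rcases Nat.mod_two_eq_zero_or_one n with hn | hn
  swap
  · obtain ⟨x, y, z, w, h, hs⟩ := exists_four_squares_sum_eq_one_of_odd hn
    exact ⟨x, y, z, w, h, 1, by rw [hs]; norm_num⟩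
  by_cases h64 : n % 64 = 0
  · obtain ⟨x, y, z, w, h, t, hs⟩ := ih (n / 64) (by lia)
    have hn' : (n : ℤ) = 64 * (n / 64 : ℕ) := by lia
    exact ⟨8 * x, 8 * y, 8 * z, 8 * w, by rw [hn', h]; ring, 2 * t, by linear_combination 8 * hs⟩
  by_cases h28 : n % 32 = 28
  · obtain ⟨a, b, c, h⟩ := sum_three_squares_of_odd (n := n / 4 - 4) (by lia)
    have hn' : (n : ℤ) = 4 * (n / 4 - 4 : ℕ) + 16 := by lia
    obtain ⟨x, y, z, w, h, hs⟩ := exists_four_squares_sum_eq_two_mul hn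
      (s := 4) (a := 2 * a) (b := 2 * b) (c := 2 * c) (by rw [hn', h]; ring)
    exact ⟨x, y, z, w, h, 2, by rw [hs]; norm_num⟩
  by_cases h112 : n % 128 = 112
  · obtain ⟨a, b, c, h⟩ := sum_three_squares_of_mod_four_eq_two (n := n / 16 - 1) (by lia)
    have hn' : (n : ℤ) = 16 * (n / 16 - 1 : ℕ) + 16 := by lia
    obtain ⟨x, y, z, w, h, hs⟩ := exists_four_squares_sum_eq_two_mul hn
      (s := 4) (a := 4 * a) (b := 4 * b) (c := 4 * c) (by rw [hn', h]; ring)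
    exact ⟨x, y, z, w, h, 2, by rw [hs]; norm_num⟩
  have hzero : ∃ x y z w : ℤ, (n : ℤ) = x ^ 2 + y ^ 2 + z ^ 2 + w ^ 2 ∧ x + y + z + w = 0 := by
    by_cases h16 : n % 16 = 0
    · exact exists_four_squares_sum_eq_zero (k := 4) (u := n / 16) (by lia) hn (by lia)
    by_cases h4 : n % 4 = 0
    · exact exists_four_squares_sum_eq_zero (k := 2) (u := n / 4) (by lia) hn (by lia)
    · exact exists_four_squares_sum_eq_zero (k := 1) (u := n) (by lia) hn (by lia)
  obtain ⟨x, y, z, w, h, hs⟩ := hzero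
  exact ⟨x, y, z, w, h, 0, by rw [hs]; norm_num⟩

theorem stmt_4 (m : ℕ) (hm : m = 2 ∨ m = 3) (n : ℕ) :
    ∃ x y z w : ℤ, (n : ℤ) = x ^ 2 + y ^ 2 + z ^ 2 + w ^ 2 ∧
      ∃ t : ℤ, x + y + z + w = t ^ m := by
  rcases hm with rfl | rfl
  · exact exists_four_squares_sum_eq_sq n
  · exact exists_four_squares_sum_eq_cube n
end

section
/- Let m and n be positive integers with n ≡ 28 (mod 32). If there exist integers x, y, z, w and an integer t such that n = x^2 + y^2 + z^2 + w^2 and x + y + z + w = t^m, then m ≤ 3. -/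
theorem sum_three_sq_not_seven_mod_eight (a b c k : ℤ) :
    a ^ 2 + b ^ 2 + c ^ 2 ≠ 8 * k + 7 := by
  intro h
  have key : ∀ a b c : ZMod 8, a ^ 2 + b ^ 2 + c ^ 2 ≠ 7 := by decide
  apply key a b c
  have h8 : (8 : ZMod 8) = 0 := rfl
  have := congrArg (Int.cast : ℤ → ZMod 8) h
  push_cast at this
  rw [this, h8]
  ring

theorem even_of_four_dvd_sum_three_sq {a b c : ℤ} (h : 4 ∣ a ^ 2 + b ^ 2 + c ^ 2) :
    Even a ∧ Even b ∧ Even c := by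
  obtain ⟨a', rfl | rfl⟩ := Int.even_or_odd' a <;>
  obtain ⟨b', rfl | rfl⟩ := Int.even_or_odd' b <;>
  obtain ⟨c', rfl | rfl⟩ := Int.even_or_odd' c <;>
  first
  | exact ⟨even_two_mul _, even_two_mul _, even_two_mul _⟩
  | (exfalso; ring_nf at h; omega)

theorem sum_three_sq_not_twenty_eight_mod_thirty_two (a b c k : ℤ) :
    a ^ 2 + b ^ 2 + c ^ 2 ≠ 32 * k + 28 := by
  intro h
  obtain ⟨ha, hb, hc⟩ := even_of_four_dvd_sum_three_sq (a := a) (b := b) (c := c) (by omega)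
  obtain ⟨a', rfl⟩ := ha.two_dvd
  obtain ⟨b', rfl⟩ := hb.two_dvd
  obtain ⟨c', rfl⟩ := hc.two_dvd
  exact sum_three_sq_not_seven_mod_eight a' b' c' k (by linarith)

theorem even_sum_of_even_sum_sq {x y z w : ℤ} (h : Even (x ^ 2 + y ^ 2 + z ^ 2 + w ^ 2)) :
    Even (x + y + z + w) := by
  simpa [Int.even_add, Int.even_pow] using h

theorem stmt_5 (m n : ℕ) (hm : 0 < m) (hn : 0 < n) (hcong : (32 : ℤ) ∣ (n : ℤ) - 28)
    (h : ∃ x y z w t : ℤ, (n : ℤ) = x ^ 2 + y ^ 2 + z ^ 2 + w ^ 2 ∧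
      x + y + z + w = t ^ m) :
    m ≤ 3 := by
  obtain ⟨x, y, z, w, t, hsq, hsum⟩ := h
  obtain ⟨k, hk⟩ := hcong
  by_contra! hm4
  have hs : Even (t ^ m) := by
    rw [← hsum]
    exact even_sum_of_even_sum_sq ⟨16 * k + 14, by linarith⟩
  have ht : (2 : ℤ) ∣ t := (Int.even_pow.mp hs).1.two_dvd
  obtain ⟨j, hj⟩ : (2 : ℤ) ^ 4 ∣ t ^ m := (pow_dvd_pow_of_dvd ht 4).trans (pow_dvd_pow t hm4)
  obtain rfl : w = 16 * j - x - y - z := by linarith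
  apply sum_three_sq_not_twenty_eight_mod_thirty_two (x + y) (y + z) (z + x)
    (k - 8 * j ^ 2 + j * (x + y + z))
  linear_combination hk - hsq
end
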